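/- (Estimate (5.22), the S₂ integral) Fix an integer l ≥ 1 and an irrational θ > 0 of finite approximation type γ ≥ 1. For every ε > 0 there exist C > 0 and T₀ ≥ 3 such that for all T ≥ T₀, setting H = T² and J = ⌊(log T − log log T)/(2 log 2)⌋ and S₂(x) = (2^{3−2l}·x^{2l−1/2}/(π²·((l−1)!)²)) · Σ u(h₁,r₁)·u(h₂,r₂)·cos(2π√x·(√(h₁(2r₁ − θh₁)) − √(h₂(2r₂ − θh₂)))), where the sum runs over positive integers h₁, h₂, r₁, r₂ with 1 ≤ hⱼ ≤ H, θhⱼ < rⱼ ≤ θhⱼ(2^{2J+1} + 1/2) for j = 1, 2, and √(h₁(2r₁ − θh₁)) ≠ √(h₂(2r₂ − θh₂)), one has |∫_T^{2T} S₂(x) dx| ≤ C·T^{2l + 1/2 − 1/(2(1+γ)) + ε}. -/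

import Mathlib

open Finset

/-- An irrational real `α` is of finite approximation type `γ` if `γ ≥ 1` and for every
`ε > 0` there is `c(ε) > 0` with `|α − p/q| ≥ c(ε)·q^{−γ−1−ε}` for all integers `p` and all
positive integers `q`. -/
def IsApproxType (α γ : ℝ) : Prop :=
  1 ≤ γ ∧ ∀ ε : ℝ, 0 < ε → ∃ c : ℝ, 0 < c ∧
    ∀ p : ℤ, ∀ q : ℕ, 0 < q → |α - (p : ℝ) / q| ≥ c * (q : ℝ) ^ (-γ - 1 - ε)

/-- `R₁(x,H) = (2^{2−l}/((l−1)!·π)) · Σ_{1≤h≤H} ((−1)^{lh}/h) ·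
Σ_{1≤m≤√(x/θ)} m·(x − θm²)^{l−1}·sin(2πh(x/(2m) − θm/2))`. -/
noncomputable def R1 (l : ℕ) (θ : ℝ) (x H : ℝ) : ℝ :=
  ((2 : ℝ) ^ ((2 : ℤ) - l) / ((l - 1).factorial * Real.pi)) *
    ∑ h ∈ Finset.Icc 1 ⌊H⌋₊, ((-1 : ℝ) ^ (l * h) / h) *
      ∑ m ∈ Finset.Icc 1 ⌊Real.sqrt (x / θ)⌋₊,
        (m : ℝ) * (x - θ * m ^ 2) ^ (l - 1) *
          Real.sin (2 * Real.pi * h * (x / (2 * m) - θ * m / 2))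

/-- `u(h,r) = (−1)^{lh}·h^{−1/4}·(2r − θh)^{−5/4}·(1 − θh/(2r − θh))^{l−1}`. -/
noncomputable def uCoef (l : ℕ) (θ : ℝ) (h r : ℕ) : ℝ :=
  (-1 : ℝ) ^ (l * h) * (h : ℝ) ^ (-(1 : ℝ) / 4) *
    (2 * (r : ℝ) - θ * h) ^ (-(5 : ℝ) / 4) *
    (1 - θ * h / (2 * (r : ℝ) - θ * h)) ^ (l - 1)

/-- `J = ⌊(log T − log log T)/(2 log 2)⌋`. -/
noncomputable def Jdef (T : ℝ) : ℕ :=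
  ⌊(Real.log T - Real.log (Real.log T)) / (2 * Real.log 2)⌋₊

/-- `R₁₁(x,H) = (2^{2−l}/((l−1)!·π))·x^{l−1/4}·Σ_{1≤h≤H}
Σ_{θh < r ≤ θh(2^{2J+1}+1/2)} u(h,r)·cos(2π√(x·h(2r − θh)) − π/4)`, with `J = Jdef T`. -/
noncomputable def R11 (l : ℕ) (θ : ℝ) (T x H : ℝ) : ℝ :=
  ((2 : ℝ) ^ ((2 : ℤ) - l) / ((l - 1).factorial * Real.pi)) * x ^ ((l : ℝ) - 1 / 4) *
    ∑ h ∈ Finset.Icc 1 ⌊H⌋₊,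
      ∑ r ∈ Finset.Ioc ⌊θ * h⌋₊ ⌊θ * h * (2 ^ (2 * Jdef T + 1) + 1 / 2)⌋₊,
        uCoef l θ h r *
          Real.cos (2 * Real.pi * Real.sqrt (x * h * (2 * (r : ℝ) - θ * h)) - Real.pi / 4)

open Classical in
/-- `C_{l,θ} = Σ_{h=1}^∞ Σ_{r > θh} (1 − θh/(2r − θh))^{2l−2}·h^{−1/2}·(2r − θh)^{−5/2}`. -/
noncomputable def Cconst (l : ℕ) (θ : ℝ) : ℝ :=
  ∑' p : ℕ × ℕ,
    if 1 ≤ p.1 ∧ 1 ≤ p.2 ∧ θ * p.1 < (p.2 : ℝ) then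
      (1 - θ * p.1 / (2 * (p.2 : ℝ) - θ * p.1)) ^ (2 * l - 2) *
        (p.1 : ℝ) ^ (-(1 : ℝ) / 2) * (2 * (p.2 : ℝ) - θ * p.1) ^ (-(5 : ℝ) / 2)
    else 0

/-- The `p`-series `∑ j^{-1-e}`; the term at `0` vanishes. -/
noncomputable def pSeries (e : ℝ) : ℝ := ∑' j : ℕ, (j : ℝ) ^ (-1 - e)

lemma summable_pSeries {e : ℝ} (he : 0 < e) : Summable fun j : ℕ => (j : ℝ) ^ (-1 - e) :=
  Real.summable_nat_rpow.2 (by linarith)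

lemma sum_le_pSeries {e : ℝ} (he : 0 < e) (S : Finset ℕ) :
    ∑ j ∈ S, (j : ℝ) ^ (-1 - e) ≤ pSeries e :=
  (summable_pSeries he).sum_le_tsum S fun _ _ => by positivity

lemma one_le_pSeries {e : ℝ} (he : 0 < e) : 1 ≤ pSeries e := by
  simpa using sum_le_pSeries he {1}

lemma sum_rpow_le_of_separated {e q : ℝ} (he : 0 < e) (hq : 0 < q) (S : Finset ℕ)
    (h1 : ∀ n ∈ S, q ≤ n) (h2 : ∀ n ∈ S, ∀ n' ∈ S, n < n' → q ≤ (n' : ℝ) - n) :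
    ∑ n ∈ S, (n : ℝ) ^ (-1 - e) ≤ q ^ (-1 - e) * pSeries e := by
  have hinj : Set.InjOn (fun n : ℕ => ⌊(n : ℝ) / q⌋₊) S := by
    have key : ∀ n ∈ S, ∀ n' ∈ S, n < n' → ⌊(n : ℝ) / q⌋₊ < ⌊(n' : ℝ) / q⌋₊ := by
      intro n hn n' hn' hlt
      rw [Nat.lt_iff_add_one_le, Nat.le_floor_iff (by positivity)]
      have h3 := Nat.floor_le (show 0 ≤ (n : ℝ) / q by positivity)
      have h4 := h2 n hn n' hn' hlt
      have h5 : (n : ℝ) / q + 1 ≤ n' / q := by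
        rw [div_add_one hq.ne', div_le_div_iff_of_pos_right hq]; linarith
      push_cast
      linarith
    intro n hn n' hn' heq
    rcases lt_trichotomy n n' with h | h | h
    · exact absurd heq (key n hn n' hn' h).ne
    · exact h
    · exact absurd heq (key n' hn' n hn h).ne'
  calc ∑ n ∈ S, (n : ℝ) ^ (-1 - e)
      ≤ ∑ n ∈ S, q ^ (-1 - e) * ((⌊(n : ℝ) / q⌋₊ : ℕ) : ℝ) ^ (-1 - e) := by
        refine Finset.sum_le_sum fun n hn => ?_
        have h3 : 1 ≤ ⌊(n : ℝ) / q⌋₊ := by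
          rw [Nat.le_floor_iff (by positivity)]
          rw [Nat.cast_one, le_div_iff₀ hq]; linarith [h1 n hn]
        have h4 : (1 : ℝ) ≤ (⌊(n : ℝ) / q⌋₊ : ℕ) := by exact_mod_cast h3
        rw [← Real.mul_rpow hq.le (by positivity)]
        refine Real.rpow_le_rpow_of_nonpos (by positivity) ?_ (by linarith)
        have h5 := Nat.floor_le (show 0 ≤ (n : ℝ) / q by positivity)
        rw [le_div_iff₀ hq] at h5
        linarith
    _ = q ^ (-1 - e) * ∑ j ∈ S.image (fun n : ℕ => ⌊(n : ℝ) / q⌋₊), (j : ℝ) ^ (-1 - e) := by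
        rw [Finset.sum_image hinj, Finset.mul_sum]
    _ ≤ _ := by
        gcongr
        exact sum_le_pSeries he _

lemma sum_Icc_rpow_le {e k : ℝ} (he : 0 < e) (hk : 0 ≤ k + e) (M : ℕ) :
    ∑ n ∈ Finset.Icc 1 M, (n : ℝ) ^ (-1 + k) ≤ (M : ℝ) ^ (k + e) * pSeries e := by
  calc ∑ n ∈ Finset.Icc 1 M, (n : ℝ) ^ (-1 + k)
      ≤ ∑ n ∈ Finset.Icc 1 M, (M : ℝ) ^ (k + e) * (n : ℝ) ^ (-1 - e) := by
        refine Finset.sum_le_sum fun n hn => ?_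
        rw [Finset.mem_Icc] at hn
        have hn0 : (0 : ℝ) < n := by exact_mod_cast hn.1
        have hnM : (n : ℝ) ≤ M := by exact_mod_cast hn.2
        rw [show -1 + k = (k + e) + (-1 - e) by ring, Real.rpow_add hn0]
        gcongr
    _ = (M : ℝ) ^ (k + e) * ∑ n ∈ Finset.Icc 1 M, (n : ℝ) ^ (-1 - e) := by rw [Finset.mul_sum]
    _ ≤ _ := by
        gcongr
        exact sum_le_pSeries he _

/-- Distance to the nearest integer. -/
noncomputable def distInt (x : ℝ) : ℝ := |x - round x|

lemma distInt_nonneg (x : ℝ) : 0 ≤ distInt x := abs_nonneg _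

/-- If `c (w x)^{-g} ≤ y` then `x` is at least `(c/y)^{1/g} / w`. -/
lemma le_of_rpow_neg_le {c g w y x : ℝ} (hc : 0 < c) (hg : 0 < g) (hw : 0 < w) (hy : 0 < y)
    (hx : 0 < x) (h : c * (w * x) ^ (-g) ≤ y) : (c / y) ^ (1 / g) / w ≤ x := by
  rw [div_le_iff₀ hw]
  have h1 : c / y ≤ (w * x) ^ g := by
    rw [Real.rpow_neg (by positivity), ← div_eq_mul_inv, div_le_iff₀ (by positivity)] at h
    rw [div_le_iff₀ hy]; linarith
  calc (c / y) ^ (1 / g) ≤ ((w * x) ^ g) ^ (1 / g) := by gcongr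
    _ = w * x := by
        rw [← Real.rpow_mul (by positivity), mul_one_div_cancel hg.ne', Real.rpow_one]
    _ = x * w := mul_comm _ _

lemma exists_sum_distInt_rpow_le {α c g e lam s : ℝ} (hc : 0 < c) (hg : 0 < g) (he : 0 < e)
    (hlam : 0 < lam) (hs : g * lam < s) (hs1 : s ≤ 1)
    (hα : ∀ q : ℕ, 0 < q → ∀ z : ℤ, c * (q : ℝ) ^ (-g) ≤ |α * q - z|) :
    ∃ C : ℝ, 0 < C ∧ ∀ w : ℕ, 0 < w → ∀ S : Finset ℕ, (∀ n ∈ S, 0 < n) →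
      ∑ n ∈ S, (n : ℝ) ^ (-1 - e) * distInt (α * (w * n : ℕ)) ^ (-lam) ≤ C * (w : ℝ) ^ s := by
  set ρ : ℝ := 2 ^ (lam - s / g) with hρ
  have hρ0 : 0 < ρ := by positivity
  have hρ1 : ρ < 1 := by
    refine Real.rpow_lt_one_of_one_lt_of_neg (by norm_num) ?_
    rw [sub_neg, lt_div_iff₀ hg]; linarith
  have hs0 : 0 < s := lt_trans (by positivity) hs
  set A : ℝ := 2 ^ lam * (c / 2) ^ (-(s / g)) * pSeries e with hA
  have hZ := one_le_pSeries he
  have hA0 : 0 < A := by positivity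
  refine ⟨A * (1 - ρ)⁻¹, mul_pos hA0 (inv_pos.2 (by linarith)), fun w hw S hS => ?_⟩
  have hw0 : (0 : ℝ) < w := by exact_mod_cast hw
  have hpos : ∀ n ∈ S, 0 < distInt (α * (w * n : ℕ)) := fun n hn => by
    have hn0 := hS n hn
    refine lt_of_lt_of_le ?_ (hα (w * n) (by positivity) (round (α * (w * n : ℕ))))
    have : (0 : ℝ) < (w * n : ℕ) := by exact_mod_cast Nat.mul_pos hw hn0
    positivity
  have hj : ∀ n : ℕ, ∃ j : ℕ, n ∈ S →
      (1 / 2 : ℝ) ^ (j + 1) < distInt (α * (w * n : ℕ)) ∧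
        distInt (α * (w * n : ℕ)) ≤ (1 / 2) ^ j := by
    intro n
    by_cases hn : n ∈ S
    · obtain ⟨j, h1, h2⟩ := exists_nat_pow_near_of_lt_one (hpos n hn)
        ((abs_sub_round _).trans (by norm_num)) (show (0 : ℝ) < 1 / 2 by norm_num) (by norm_num)
      exact ⟨j, fun _ => ⟨h1, h2⟩⟩
    · exact ⟨0, fun h => absurd h hn⟩
  choose j hj using hj
  have hfib : ∀ i : ℕ, ∑ n ∈ S with j n = i,
      (n : ℝ) ^ (-1 - e) * distInt (α * (w * n : ℕ)) ^ (-lam) ≤ A * (w : ℝ) ^ s * ρ ^ i := by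
    intro i
    set Q : ℝ := (c / (2 * (1 / 2) ^ i)) ^ (1 / g) / w with hQ
    have hQ0 : 0 < Q := by positivity
    have hsep := sum_rpow_le_of_separated he (q := max 1 Q) (by positivity) (S.filter (j · = i))
      (by
        intro n hn
        rw [Finset.mem_filter] at hn
        have hn0 := hS n hn.1
        refine max_le (by exact_mod_cast hn0) ?_
        refine le_of_rpow_neg_le hc hg hw0 (by positivity) (by exact_mod_cast hn0) ?_
        have h1 := hα (w * n) (by positivity) (round (α * (w * n : ℕ)))
        have h2 := (hj n hn.1).2
        rw [hn.2] at h2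
        push_cast at h1 h2 ⊢
        have h3 : (0 : ℝ) < (1 / 2) ^ i := by positivity
        unfold distInt at h2
        linarith)
      (by
        intro n hn n' hn' hlt
        rw [Finset.mem_filter] at hn hn'
        rw [← Nat.cast_sub hlt.le]
        have hd0 : 0 < n' - n := Nat.sub_pos_of_lt hlt
        refine max_le (by exact_mod_cast hd0) ?_
        refine le_of_rpow_neg_le hc hg hw0 (by positivity) (by exact_mod_cast hd0) ?_
        have h1 := hα (w * (n' - n)) (by positivity)
          (round (α * (w * n' : ℕ)) - round (α * (w * n : ℕ)))
        have h2 := (hj n hn.1).2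
        have h3 := (hj n' hn'.1).2
        rw [hn.2] at h2
        rw [hn'.2] at h3
        unfold distInt at h2 h3
        rw [← Nat.cast_mul]
        refine h1.trans ?_
        have h4 : α * (w * (n' - n) : ℕ) -
            ((round (α * (w * n' : ℕ)) - round (α * (w * n : ℕ)) : ℤ) : ℝ) =
            (α * (w * n' : ℕ) - round (α * (w * n' : ℕ))) -
              (α * (w * n : ℕ) - round (α * (w * n : ℕ))) := by
          push_cast [Nat.cast_sub hlt.le]; ring
        rw [h4]
        refine (abs_sub _ _).trans ?_
        linarith)
    calc ∑ n ∈ S with j n = i, (n : ℝ) ^ (-1 - e) * distInt (α * (w * n : ℕ)) ^ (-lam)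
        ≤ ∑ n ∈ S with j n = i, (n : ℝ) ^ (-1 - e) * ((1 / 2 : ℝ) ^ (i + 1)) ^ (-lam) := by
          refine Finset.sum_le_sum fun n hn => ?_
          rw [Finset.mem_filter] at hn
          have h1 := (hj n hn.1).1
          rw [hn.2] at h1
          gcongr ?_ * ?_
          exact Real.rpow_le_rpow_of_nonpos (by positivity) h1.le (by linarith)
      _ = (∑ n ∈ S with j n = i, (n : ℝ) ^ (-1 - e)) * ((1 / 2 : ℝ) ^ (i + 1)) ^ (-lam) := by
          rw [Finset.sum_mul]
      _ ≤ (max 1 Q ^ (-1 - e) * pSeries e) * ((1 / 2 : ℝ) ^ (i + 1)) ^ (-lam) := by gcongr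
      _ ≤ (Q ^ (-s) * pSeries e) * ((1 / 2 : ℝ) ^ (i + 1)) ^ (-lam) := by
          gcongr ?_ * _ * _
          calc max 1 Q ^ (-1 - e) ≤ max 1 Q ^ (-s) :=
                Real.rpow_le_rpow_of_exponent_le (le_max_left _ _) (by linarith)
            _ ≤ Q ^ (-s) :=
                Real.rpow_le_rpow_of_nonpos hQ0 (le_max_right _ _) (by linarith)
      _ = A * (w : ℝ) ^ s * ρ ^ i := by
          have e1 : ((1 / 2 : ℝ) ^ (i + 1)) ^ (-lam) = 2 ^ lam * (2 : ℝ) ^ (lam * i) := by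
            rw [one_div, inv_pow, Real.inv_rpow (by positivity), Real.rpow_neg (by positivity),
              inv_inv, ← Real.rpow_natCast, ← Real.rpow_mul (by norm_num),
              ← Real.rpow_add (by norm_num)]
            congr 1; push_cast; ring
          have e2 : Q ^ (-s) = (c / 2) ^ (-(s / g)) * (2 : ℝ) ^ (-(s / g) * i) * (w : ℝ) ^ s := by
            have e3 : c / (2 * (1 / 2 : ℝ) ^ i) = (c / 2) * (2 : ℝ) ^ (i : ℝ) := by
              rw [Real.rpow_natCast, one_div, inv_pow]; field_simp
            rw [hQ, e3, Real.div_rpow (by positivity) (by positivity),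
              Real.rpow_neg hw0.le, div_inv_eq_mul, ← Real.rpow_mul (by positivity),
              Real.mul_rpow (by positivity) (by positivity), ← Real.rpow_mul (by norm_num)]
            congr 3
            · ring
            · ring
          rw [e1, e2, hA, hρ, ← Real.rpow_natCast, ← Real.rpow_mul (by norm_num),
            show (lam - s / g) * (i : ℝ) = lam * i + -(s / g) * i by ring,
            Real.rpow_add (by norm_num)]
          ring
  have hmaps : ∀ n ∈ S, j n ∈ S.image j := fun n hn => Finset.mem_image_of_mem j hn
  rw [← Finset.sum_fiberwise_of_maps_to hmaps]
  calc _ ≤ ∑ i ∈ S.image j, A * (w : ℝ) ^ s * ρ ^ i := Finset.sum_le_sum fun i _ => hfib i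
    _ = A * (w : ℝ) ^ s * ∑ i ∈ S.image j, ρ ^ i := by rw [Finset.mul_sum]
    _ ≤ A * (w : ℝ) ^ s * (1 - ρ)⁻¹ := by
        gcongr
        rw [← tsum_geometric_of_lt_one hρ0.le hρ1]
        exact (summable_geometric_of_lt_one hρ0.le hρ1).sum_le_tsum _ fun _ _ => by positivity
    _ = _ := by ring

lemma sum_gcd_le (f : ℕ → ℕ → ℕ → ℝ) (hf : ∀ g m n, 0 ≤ f g m n) (H : ℕ) :
    ∑ h₁ ∈ Finset.Icc 1 H, ∑ h₂ ∈ Finset.Icc 1 h₁,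
        f (h₁.gcd h₂) ((h₁ - h₂) / h₁.gcd h₂) ((h₁ + h₂) / h₁.gcd h₂) ≤
      ∑ g ∈ Finset.Icc 1 H, ∑ m ∈ Finset.range (2 * H + 1), ∑ n ∈ Finset.Icc 1 (2 * H),
        f g m n := by
  have hR : ∑ g ∈ Finset.Icc 1 H, ∑ m ∈ Finset.range (2 * H + 1), ∑ n ∈ Finset.Icc 1 (2 * H),
      f g m n = ∑ x ∈ Finset.Icc 1 H ×ˢ Finset.range (2 * H + 1) ×ˢ Finset.Icc 1 (2 * H),
        f x.1 x.2.1 x.2.2 := by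
    rw [Finset.sum_product]
    refine Finset.sum_congr rfl fun g _ => ?_
    rw [Finset.sum_product]
  rw [hR, Finset.sum_sigma']
  set φ : ((_ : ℕ) × ℕ) → ℕ × ℕ × ℕ := fun p =>
    (p.1.gcd p.2, (p.1 - p.2) / p.1.gcd p.2, (p.1 + p.2) / p.1.gcd p.2) with hφ
  have hdvd : ∀ a b : ℕ, a.gcd b * ((a - b) / a.gcd b) = a - b ∧
      a.gcd b * ((a + b) / a.gcd b) = a + b := fun a b =>
    ⟨Nat.mul_div_cancel' (Nat.dvd_sub (Nat.gcd_dvd_left a b) (Nat.gcd_dvd_right a b)),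
      Nat.mul_div_cancel' (Nat.dvd_add (Nat.gcd_dvd_left a b) (Nat.gcd_dvd_right a b))⟩
  have hinj : Set.InjOn φ ((Finset.Icc 1 H).sigma fun h₁ => Finset.Icc 1 h₁) := by
    rintro ⟨a, b⟩ hp ⟨a', b'⟩ hp' heq
    simp only [Finset.coe_sigma, Set.mem_sigma_iff, Finset.coe_Icc, Set.mem_Icc] at hp hp'
    simp only [hφ, Prod.mk.injEq] at heq
    obtain ⟨h1, h2, h3⟩ := heq
    obtain ⟨k1, k2⟩ := hdvd a b
    obtain ⟨k1', k2'⟩ := hdvd a' b'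
    rw [h2, h1, k1'] at k1
    rw [h3, h1, k2'] at k2
    obtain rfl : a = a' := by omega
    obtain rfl : b = b' := by omega
    rfl
  calc _ = ∑ x ∈ ((Finset.Icc 1 H).sigma fun h₁ => Finset.Icc 1 h₁).image φ,
        f x.1 x.2.1 x.2.2 := (Finset.sum_image hinj).symm
    _ ≤ _ := by
        refine Finset.sum_le_sum_of_subset_of_nonneg ?_ fun _ _ _ => hf _ _ _
        intro x hx
        obtain ⟨⟨a, b⟩, hp, rfl⟩ := Finset.mem_image.1 hx
        simp only [Finset.mem_sigma, Finset.mem_Icc] at hp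
        have hg : 0 < a.gcd b := Nat.gcd_pos_of_pos_left _ (by omega)
        have hga : a.gcd b ≤ a := Nat.gcd_le_left _ (by omega)
        obtain ⟨k1, k2⟩ := hdvd a b
        have l1 : (a - b) / a.gcd b ≤ a - b := Nat.div_le_self _ _
        have l2 : (a + b) / a.gcd b ≤ a + b := Nat.div_le_self _ _
        have l3 : 0 < (a + b) / a.gcd b := Nat.div_pos (by omega) hg
        simp only [hφ, Finset.mem_product, Finset.mem_Icc, Finset.mem_range]
        omega

/-- A Schur-test bound for the kernel `1/(1+|m-n|)`. -/
lemma sum_kernel_le {ι : Type*} {e : ℝ} (he : 0 < e) (S : Finset ι) (x : ι → ℝ)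
    (ν : ι → ℕ) (M : ℕ) (hν : ∀ p ∈ S, ν p < M) :
    ∑ p ∈ S, ∑ q ∈ S, x p * x q / (1 + |(ν p : ℝ) - ν q|) ≤
      2 * ((M : ℝ) ^ e * pSeries e) *
        ∑ p ∈ S, ∑ q ∈ S, if ν p = ν q then x p * x q else 0 := by
  set X : ℕ → ℝ := fun n => ∑ p ∈ S with ν p = n, x p with hX
  have hmaps : ∀ p ∈ S, ν p ∈ Finset.range M := fun p hp => Finset.mem_range.2 (hν p hp)
  have hcol : ∀ k : ℕ → ℕ → ℝ, ∑ p ∈ S, ∑ q ∈ S, x p * x q * k (ν p) (ν q) =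
      ∑ m ∈ Finset.range M, ∑ n ∈ Finset.range M, X m * X n * k m n := by
    intro k
    rw [← Finset.sum_fiberwise_of_maps_to hmaps]
    refine Finset.sum_congr rfl fun m _ => ?_
    have : ∀ p ∈ S.filter (ν · = m), ∑ q ∈ S, x p * x q * k (ν p) (ν q) =
        x p * ∑ n ∈ Finset.range M, X n * k m n := by
      intro p hp
      rw [Finset.mem_filter] at hp
      rw [← Finset.sum_fiberwise_of_maps_to hmaps, Finset.mul_sum]
      refine Finset.sum_congr rfl fun n _ => ?_
      rw [hX, Finset.sum_mul, Finset.mul_sum]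
      refine Finset.sum_congr rfl fun q hq => ?_
      rw [Finset.mem_filter] at hq
      rw [hp.2, hq.2]; ring
    rw [Finset.sum_congr rfl this, ← Finset.sum_mul, Finset.mul_sum]
    refine Finset.sum_congr rfl fun n _ => by rw [hX]; ring
  have hrow : ∀ m ∈ Finset.range M, ∑ n ∈ Finset.range M, 1 / (1 + |(m : ℝ) - n|) ≤
      2 * ((M : ℝ) ^ e * pSeries e) := by
    intro m hm
    rw [Finset.mem_range] at hm
    have hharm : ∑ d ∈ Finset.Icc 1 M, ((d : ℝ))⁻¹ ≤ (M : ℝ) ^ e * pSeries e := by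
      have := sum_Icc_rpow_le (k := 0) he (by linarith) M
      simpa [Real.rpow_neg_one] using this
    have h1 : ∑ n ∈ Finset.range M with n ≤ m, 1 / (1 + |(m : ℝ) - n|) ≤
        ∑ d ∈ Finset.Icc 1 M, ((d : ℝ))⁻¹ := by
      have hinj : Set.InjOn (fun n : ℕ => m - n + 1)
          ((Finset.range M).filter (· ≤ m)) := by
        intro a ha b hb hab
        simp only [Finset.coe_filter, Finset.mem_range, Set.mem_ofPred_eq] at ha hb hab
        omega
      calc _ = ∑ n ∈ Finset.range M with n ≤ m, (((m - n + 1 : ℕ) : ℝ))⁻¹ := by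
            refine Finset.sum_congr rfl fun n hn => ?_
            rw [Finset.mem_filter] at hn
            have : (n : ℝ) ≤ m := by exact_mod_cast hn.2
            rw [abs_of_nonneg (by linarith), one_div]
            push_cast [Nat.cast_sub hn.2]; ring
        _ = ∑ d ∈ ((Finset.range M).filter (· ≤ m)).image (fun n : ℕ => m - n + 1),
              ((d : ℝ))⁻¹ := (Finset.sum_image (f := fun d : ℕ => ((d : ℝ))⁻¹) hinj).symm
        _ ≤ _ := by
            refine Finset.sum_le_sum_of_subset_of_nonneg ?_ fun _ _ _ => by positivity
            intro d hd
            obtain ⟨n, hn, rfl⟩ := Finset.mem_image.1 hd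
            rw [Finset.mem_filter, Finset.mem_range] at hn
            rw [Finset.mem_Icc]; omega
    have h2 : ∑ n ∈ Finset.range M with ¬ n ≤ m, 1 / (1 + |(m : ℝ) - n|) ≤
        ∑ d ∈ Finset.Icc 1 M, ((d : ℝ))⁻¹ := by
      have hinj : Set.InjOn (fun n : ℕ => n - m + 1)
          ((Finset.range M).filter (¬ · ≤ m)) := by
        intro a ha b hb hab
        simp only [Finset.coe_filter, Finset.mem_range, Set.mem_ofPred_eq] at ha hb hab
        omega
      calc _ = ∑ n ∈ Finset.range M with ¬ n ≤ m, (((n - m + 1 : ℕ) : ℝ))⁻¹ := by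
            refine Finset.sum_congr rfl fun n hn => ?_
            rw [Finset.mem_filter, not_le] at hn
            have : (m : ℝ) ≤ n := by exact_mod_cast hn.2.le
            rw [abs_of_nonpos (by linarith), one_div]
            push_cast [Nat.cast_sub hn.2.le]; ring
        _ = ∑ d ∈ ((Finset.range M).filter (¬ · ≤ m)).image (fun n : ℕ => n - m + 1),
              ((d : ℝ))⁻¹ := (Finset.sum_image (f := fun d : ℕ => ((d : ℝ))⁻¹) hinj).symm
        _ ≤ _ := by
            refine Finset.sum_le_sum_of_subset_of_nonneg ?_ fun _ _ _ => by positivity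
            intro d hd
            obtain ⟨n, hn, rfl⟩ := Finset.mem_image.1 hd
            rw [Finset.mem_filter, Finset.mem_range] at hn
            rw [Finset.mem_Icc]; omega
    rw [← Finset.sum_filter_add_sum_filter_not (Finset.range M) (· ≤ m)]
    linarith
  have hL := hcol fun m n => 1 / (1 + |(m : ℝ) - n|)
  have hD := hcol fun m n => if m = n then 1 else 0
  have hD' : ∑ p ∈ S, ∑ q ∈ S, (if ν p = ν q then x p * x q else 0) =
      ∑ m ∈ Finset.range M, X m ^ 2 := by
    calc _ = ∑ p ∈ S, ∑ q ∈ S, x p * x q * (if ν p = ν q then 1 else 0) := by simp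
      _ = _ := hD
      _ = _ := by
        refine Finset.sum_congr rfl fun m hm => ?_
        rw [Finset.sum_eq_single_of_mem m hm]
        · simp [sq]
        · intro n _ hn; simp [hn.symm]
  rw [hD']
  simp only [mul_one_div] at hL
  rw [hL]
  have hsymm : ∑ m ∈ Finset.range M, ∑ n ∈ Finset.range M, X n ^ 2 * (1 / (1 + |(m : ℝ) - n|)) =
      ∑ m ∈ Finset.range M, ∑ n ∈ Finset.range M, X m ^ 2 * (1 / (1 + |(m : ℝ) - n|)) := by
    rw [Finset.sum_comm]
    simp only [abs_sub_comm]
  calc ∑ m ∈ Finset.range M, ∑ n ∈ Finset.range M, X m * X n / (1 + |(m : ℝ) - n|)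
      ≤ ∑ m ∈ Finset.range M, ∑ n ∈ Finset.range M,
          (X m ^ 2 * (1 / (1 + |(m : ℝ) - n|)) / 2 + X n ^ 2 * (1 / (1 + |(m : ℝ) - n|)) / 2) := by
        refine Finset.sum_le_sum fun m _ => Finset.sum_le_sum fun n _ => ?_
        have h0 : 0 ≤ 1 / (1 + |(m : ℝ) - n|) := by positivity
        rw [div_eq_mul_one_div]
        nlinarith [mul_nonneg h0 (sq_nonneg (X m - X n))]
    _ = ∑ m ∈ Finset.range M, ∑ n ∈ Finset.range M, X m ^ 2 * (1 / (1 + |(m : ℝ) - n|)) := by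
        simp only [Finset.sum_add_distrib, ← Finset.sum_div]
        rw [hsymm]; ring
    _ = ∑ m ∈ Finset.range M, X m ^ 2 * ∑ n ∈ Finset.range M, 1 / (1 + |(m : ℝ) - n|) := by
        simp only [Finset.mul_sum]
    _ ≤ ∑ m ∈ Finset.range M, X m ^ 2 * (2 * ((M : ℝ) ^ e * pSeries e)) :=
        Finset.sum_le_sum fun m hm => mul_le_mul_of_nonneg_left (hrow m hm) (sq_nonneg _)
    _ = _ := by rw [← Finset.sum_mul]; ring

lemma abs_integral_rpow_mul_le {b T : ℝ} (hb : 0 ≤ b) (hT : 0 < T) (f : ℝ → ℝ)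
    (hf : ∀ x, |f x| ≤ 1) : |∫ x in T..(2 * T), x ^ b * f x| ≤ 2 ^ b * T ^ (b + 1) := by
  have := intervalIntegral.norm_integral_le_of_norm_le_const (a := T) (b := 2 * T)
    (f := fun x => x ^ b * f x) (C := (2 * T) ^ b) ?_
  · rw [Real.norm_eq_abs] at this
    refine this.trans (le_of_eq ?_)
    rw [Real.mul_rpow (by norm_num) hT.le, Real.rpow_add hT, Real.rpow_one,
      abs_of_pos (by linarith)]
    ring
  · intro x hx
    rw [Set.uIoc_of_le (by linarith)] at hx
    rw [Real.norm_eq_abs, abs_mul, abs_of_nonneg (Real.rpow_nonneg (by linarith [hx.1]) _)]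
    calc x ^ b * |f x| ≤ (2 * T) ^ b * 1 := by
          gcongr
          · linarith [hx.1]
          · exact hx.2
          · exact hf x
      _ = _ := mul_one _

lemma abs_integral_cos_sqrt_le {b T κ : ℝ} (hb : 1 / 2 ≤ b) (hT : 0 < T) (hκ : κ ≠ 0) :
    |∫ x in T..(2 * T), x ^ b * Real.cos (κ * √x)| ≤
      2 / |κ| * ((2 ^ (b + 1 / 2) + 1 + (b + 1 / 2) * 2 ^ (b - 1 / 2)) * T ^ (b + 1 / 2)) := by
  have hIcc : ∀ x ∈ Set.uIcc T (2 * T), 0 < x := by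
    intro x hx
    rw [Set.uIcc_of_le (by linarith)] at hx
    linarith [hx.1]
  have hder : ∀ x ∈ Set.uIcc T (2 * T),
      HasDerivAt (fun x => 2 / κ * (x ^ (b + 1 / 2) * Real.sin (κ * √x)))
        (x ^ b * Real.cos (κ * √x) +
          2 / κ * ((b + 1 / 2) * (x ^ (b - 1 / 2) * Real.sin (κ * √x)))) x := by
    intro x hx
    have hx0 := hIcc x hx
    have h1 := (Real.hasDerivAt_rpow_const (x := x) (p := b + 1 / 2) (Or.inl hx0.ne')).mul
      (((Real.hasDerivAt_sqrt hx0.ne').const_mul κ).sin)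
    refine (h1.const_mul (2 / κ)).congr_deriv ?_
    have h2 : x ^ (b + 1 / 2) = x ^ b * √x := by
      rw [Real.rpow_add hx0, Real.sqrt_eq_rpow]
    rw [h2, show b + 1 / 2 - 1 = b - 1 / 2 by ring]
    have h3 : √x ≠ 0 := (Real.sqrt_pos.2 hx0).ne'
    field_simp
    ring
  have hc1 : ContinuousOn (fun x => x ^ b * Real.cos (κ * √x)) (Set.uIcc T (2 * T)) := by
    refine ContinuousOn.mul (fun x hx => ?_) (by fun_prop)
    exact (Real.continuousAt_rpow_const _ _ (Or.inl (hIcc x hx).ne')).continuousWithinAt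
  have hc2 : ContinuousOn (fun x => x ^ (b - 1 / 2) * Real.sin (κ * √x))
      (Set.uIcc T (2 * T)) := by
    refine ContinuousOn.mul (fun x hx => ?_) (by fun_prop)
    exact (Real.continuousAt_rpow_const _ _ (Or.inl (hIcc x hx).ne')).continuousWithinAt
  have hi1 := hc1.intervalIntegrable (μ := MeasureTheory.volume)
  have hi2 := ((hc2.intervalIntegrable (μ := MeasureTheory.volume)).const_mul
    (b + 1 / 2)).const_mul (2 / κ)
  have hFTC := intervalIntegral.integral_eq_sub_of_hasDerivAt hder (hi1.add hi2)
  rw [intervalIntegral.integral_add hi1 hi2, intervalIntegral.integral_const_mul,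
    intervalIntegral.integral_const_mul] at hFTC
  have hI := abs_integral_rpow_mul_le (b := b - 1 / 2) (by linarith) hT
    (fun x => Real.sin (κ * √x)) (fun x => Real.abs_sin_le_one _)
  rw [show b - 1 / 2 + 1 = b + 1 / 2 by ring] at hI
  set I₂ := ∫ x in T..(2 * T), x ^ (b - 1 / 2) * Real.sin (κ * √x)
  have hE : ∫ x in T..(2 * T), x ^ b * Real.cos (κ * √x) =
      2 / κ * ((2 * T) ^ (b + 1 / 2) * Real.sin (κ * √(2 * T)) -
        T ^ (b + 1 / 2) * Real.sin (κ * √T) - (b + 1 / 2) * I₂) := by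
    linarith
  rw [hE, abs_mul, abs_div, abs_two]
  gcongr
  have hp : 0 < T ^ (b + 1 / 2) := by positivity
  have t1 : |(2 * T) ^ (b + 1 / 2) * Real.sin (κ * √(2 * T))| ≤
      2 ^ (b + 1 / 2) * T ^ (b + 1 / 2) := by
    rw [abs_mul, ← Real.mul_rpow (by norm_num) hT.le, abs_of_pos (by positivity)]
    exact mul_le_of_le_one_right (by positivity) (Real.abs_sin_le_one _)
  have t2 : |T ^ (b + 1 / 2) * Real.sin (κ * √T)| ≤ T ^ (b + 1 / 2) := by
    rw [abs_mul, abs_of_pos hp]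
    exact mul_le_of_le_one_right hp.le (Real.abs_sin_le_one _)
  have t3 : |(b + 1 / 2) * I₂| ≤ (b + 1 / 2) * (2 ^ (b - 1 / 2) * T ^ (b + 1 / 2)) := by
    rw [abs_mul, abs_of_pos (by linarith)]
    gcongr
  calc _ ≤ |(2 * T) ^ (b + 1 / 2) * Real.sin (κ * √(2 * T))| +
        |T ^ (b + 1 / 2) * Real.sin (κ * √T)| + |(b + 1 / 2) * I₂| :=
        (abs_sub _ _).trans (add_le_add_left (abs_sub _ _) _)
    _ ≤ _ := by linarith

/-- `h(2r − θh)`, the square of the frequency attached to `(h, r)`. -/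
noncomputable def freq (θ : ℝ) (h r : ℕ) : ℝ := (h : ℝ) * (2 * r - θ * h)

/-- The size `h^{-1/4} (2r − θh)^{-5/4}` of the coefficients. -/
noncomputable def weight (θ : ℝ) (h r : ℕ) : ℝ :=
  (h : ℝ) ^ (-(1 : ℝ) / 4) * (2 * (r : ℝ) - θ * h) ^ (-(5 : ℝ) / 4)

lemma freq_sub_freq (θ : ℝ) (h₁ r₁ h₂ r₂ : ℕ) :
    freq θ h₁ r₁ - freq θ h₂ r₂ = 2 * ((h₁ * r₁ - h₂ * r₂ : ℤ) : ℝ) -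
      θ * ((h₁ : ℝ) ^ 2 - (h₂ : ℝ) ^ 2) := by
  unfold freq; push_cast; ring

section Pointwise

variable {θ : ℝ} {h r h₁ h₂ r₁ r₂ : ℕ}

lemma lt_two_mul_sub (hr : θ * h < r) : (r : ℝ) < 2 * r - θ * h := by linarith

lemma two_mul_sub_pos (hθ : 0 < θ) (hr : θ * h < r) : 0 < 2 * (r : ℝ) - θ * h := by
  have : 0 ≤ θ * h := by positivity
  linarith

lemma le_freq (hr : θ * h < r) : θ * (h : ℝ) ^ 2 ≤ freq θ h r := by
  unfold freq
  have h0 : (0 : ℝ) ≤ h := by positivity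
  nlinarith

lemma freq_pos (hθ : 0 < θ) (hh : 0 < h) (hr : θ * h < r) : 0 < freq θ h r :=
  mul_pos (by exact_mod_cast hh) (two_mul_sub_pos hθ hr)

lemma theta_le_freq (hθ : 0 < θ) (hh : 0 < h) (hr : θ * h < r) : θ ≤ freq θ h r := by
  have h1 : (1 : ℝ) ≤ h := by exact_mod_cast hh
  have := le_freq hr
  nlinarith [one_le_pow₀ h1 (n := 2)]

lemma weight_pos (hθ : 0 < θ) (hh : 0 < h) (hr : θ * h < r) : 0 < weight θ h r := by
  have h1 : (0 : ℝ) < h := by exact_mod_cast hh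
  have h2 := two_mul_sub_pos hθ hr
  unfold weight; positivity

lemma weight_eq (hθ : 0 < θ) (hr : θ * h < r) :
    weight θ h r = freq θ h r ^ (-(1 : ℝ) / 4) * (2 * (r : ℝ) - θ * h)⁻¹ := by
  have h1 : (0 : ℝ) ≤ h := by positivity
  have h2 := two_mul_sub_pos hθ hr
  unfold weight freq
  rw [Real.mul_rpow h1 h2.le, ← Real.rpow_neg_one (2 * (r : ℝ) - θ * h), mul_assoc,
    ← Real.rpow_add h2]
  norm_num

lemma freq_le_mul_of_close (hθ : 0 < θ) (hh : 0 < h₂) (hr₂ : θ * h₂ < r₂)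
    (hclose : |freq θ h₁ r₁ - freq θ h₂ r₂| < 1) :
    freq θ h₁ r₁ ≤ (1 + 1 / θ) * freq θ h₂ r₂ := by
  have h1 := theta_le_freq hθ hh hr₂
  have h2 : 1 ≤ 1 / θ * freq θ h₂ r₂ := by
    rw [one_div, inv_mul_eq_div, le_div_iff₀ hθ]; linarith
  have := (abs_lt.1 hclose).2
  linarith

lemma inv_mul_inv_le_of_close (hθ : 0 < θ) (hh₁ : 0 < h₁) (hh₂ : 0 < h₂) (hr₁ : θ * h₁ < r₁)
    (hr₂ : θ * h₂ < r₂) (hclose : |freq θ h₁ r₁ - freq θ h₂ r₂| < 1) :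
    (2 * (r₁ : ℝ) - θ * h₁)⁻¹ * (2 * (r₂ : ℝ) - θ * h₂)⁻¹ ≤
      (1 + 1 / θ) * ((h₂ : ℝ) / h₁) * (r₁ : ℝ) ^ (-2 : ℝ) := by
  have hc := freq_le_mul_of_close hθ hh₂ hr₂ hclose
  have a1 := two_mul_sub_pos hθ hr₁
  have a2 := two_mul_sub_pos hθ hr₂
  have l1 := lt_two_mul_sub hr₁
  have H1 : (0 : ℝ) < h₁ := by exact_mod_cast hh₁
  have H2 : (0 : ℝ) < h₂ := by exact_mod_cast hh₂
  have R1 : (0 : ℝ) < r₁ := lt_of_le_of_lt (by positivity) hr₁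
  unfold freq at hc
  set A₁ := 2 * (r₁ : ℝ) - θ * h₁
  set A₂ := 2 * (r₂ : ℝ) - θ * h₂
  rw [Real.rpow_neg R1.le, Real.rpow_two]
  have key : A₂⁻¹ ≤ (1 + 1 / θ) * ((h₂ : ℝ) / h₁) * A₁⁻¹ := by
    rw [show (1 + 1 / θ) * ((h₂ : ℝ) / h₁) * A₁⁻¹ = ((1 + 1 / θ) * h₂) / (h₁ * A₁) by
      field_simp, inv_eq_one_div, div_le_div_iff₀ a2 (by positivity)]
    linarith
  calc A₁⁻¹ * A₂⁻¹ ≤ A₁⁻¹ * ((1 + 1 / θ) * ((h₂ : ℝ) / h₁) * A₁⁻¹) := by gcongr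
    _ = (1 + 1 / θ) * ((h₂ : ℝ) / h₁) * (A₁ ^ 2)⁻¹ := by rw [sq, mul_inv]; ring
    _ ≤ _ := by gcongr

lemma weight_mul_le_of_close {lam : ℝ} (hlam : 0 < lam) (hlam1 : lam ≤ 1) (hθ : 0 < θ)
    (hh₁ : 0 < h₁) (hh₂ : 0 < h₂) (hr₁ : θ * h₁ < r₁)
    (hr₂ : θ * h₂ < r₂) (hclose : |freq θ h₁ r₁ - freq θ h₂ r₂| < 1)
    (hne : freq θ h₁ r₁ ≠ freq θ h₂ r₂) :
    weight θ h₁ r₁ * weight θ h₂ r₂ * (1 / |√(freq θ h₁ r₁) - √(freq θ h₂ r₂)|) ^ lam ≤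
      ((1 + 1 / θ) ^ 2 * (2 + 1 / θ) * θ ^ (-(1 - lam) / 2)) * ((h₂ : ℝ) / h₁) *
        (r₁ : ℝ) ^ (-2 : ℝ) * (h₁ : ℝ) ^ (-(1 - lam)) *
          |freq θ h₁ r₁ - freq θ h₂ r₂| ^ (-lam) := by
  have hc := freq_le_mul_of_close hθ hh₂ hr₂ hclose
  have hc' := freq_le_mul_of_close hθ hh₁ hr₁ (by rwa [abs_sub_comm])
  have hinv := inv_mul_inv_le_of_close hθ hh₁ hh₂ hr₁ hr₂ hclose
  have a1 := two_mul_sub_pos hθ hr₁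
  have a2 := two_mul_sub_pos hθ hr₂
  have N1 := freq_pos hθ hh₁ hr₁
  have N2 := freq_pos hθ hh₂ hr₂
  have hlow := le_freq hr₁
  have H1 : (0 : ℝ) < h₁ := by exact_mod_cast hh₁
  rw [weight_eq hθ hr₁, weight_eq hθ hr₂]
  set A₁ := 2 * (r₁ : ℝ) - θ * h₁
  set A₂ := 2 * (r₂ : ℝ) - θ * h₂
  set n₁ := freq θ h₁ r₁
  set n₂ := freq θ h₂ r₂
  set κ := 1 + 1 / θ with hκ
  have hκ1 : 1 ≤ κ := by rw [hκ]; have : 0 < 1 / θ := by positivity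
                         linarith
  have hΔ : 0 < |n₁ - n₂| := abs_pos.2 (sub_ne_zero.2 hne)
  have hs : |√n₁ - √n₂| = |n₁ - n₂| / (√n₁ + √n₂) := by
    rw [eq_div_iff (by positivity), ← abs_of_pos (show 0 < √n₁ + √n₂ by positivity), ← abs_mul]
    congr 1
    nlinarith [Real.sq_sqrt N1.le, Real.sq_sqrt N2.le]
  have e1 : (1 / |√n₁ - √n₂|) ^ lam = (√n₁ + √n₂) ^ lam * |n₁ - n₂| ^ (-lam) := by
    rw [hs, one_div_div, Real.div_rpow (by positivity) (by positivity), Real.rpow_neg hΔ.le,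
      div_eq_mul_inv]
  have b1 : (√n₁ + √n₂) ^ lam ≤ (1 + κ) * n₁ ^ (lam / 2) := by
    have : √n₂ ≤ κ * √n₁ := by
      calc √n₂ ≤ √(κ ^ 2 * n₁) := Real.sqrt_le_sqrt (by nlinarith)
        _ = κ * √n₁ := by rw [Real.sqrt_mul (by positivity), Real.sqrt_sq (by linarith)]
    calc (√n₁ + √n₂) ^ lam ≤ ((1 + κ) * √n₁) ^ lam := by gcongr; linarith
      _ = (1 + κ) ^ lam * n₁ ^ (lam / 2) := by
          rw [Real.mul_rpow (by linarith) (by positivity), Real.sqrt_eq_rpow,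
            ← Real.rpow_mul N1.le]
          congr 2; ring
      _ ≤ (1 + κ) ^ (1 : ℝ) * n₁ ^ (lam / 2) := by
          gcongr
          linarith
      _ = _ := by rw [Real.rpow_one]
  have b2 : n₂ ^ (-(1 : ℝ) / 4) ≤ κ * n₁ ^ (-(1 : ℝ) / 4) := by
    calc n₂ ^ (-(1 : ℝ) / 4) ≤ (n₁ / κ) ^ (-(1 : ℝ) / 4) := by
          refine Real.rpow_le_rpow_of_nonpos (by positivity) ?_ (by norm_num)
          rw [div_le_iff₀ (by positivity)]; linarith
      _ = κ ^ ((1 : ℝ) / 4) * n₁ ^ (-(1 : ℝ) / 4) := by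
          rw [Real.div_rpow N1.le (by positivity), neg_div, Real.rpow_neg (x := κ) (by positivity),
            div_inv_eq_mul, mul_comm]
      _ ≤ κ ^ (1 : ℝ) * n₁ ^ (-(1 : ℝ) / 4) := by
          gcongr ?_ * _
          exact Real.rpow_le_rpow_of_exponent_le hκ1 (by norm_num)
      _ = _ := by rw [Real.rpow_one]
  have b3 : n₁ ^ (-(1 - lam) / 2) ≤ θ ^ (-(1 - lam) / 2) * (h₁ : ℝ) ^ (-(1 - lam)) := by
    calc n₁ ^ (-(1 - lam) / 2) ≤ (θ * (h₁ : ℝ) ^ 2) ^ (-(1 - lam) / 2) :=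
          Real.rpow_le_rpow_of_nonpos (by positivity) hlow (by linarith)
      _ = _ := by
          rw [Real.mul_rpow hθ.le (by positivity), ← Real.rpow_natCast, ← Real.rpow_mul H1.le]
          congr 2; push_cast; ring
  rw [e1]
  calc n₁ ^ (-(1 : ℝ) / 4) * A₁⁻¹ * (n₂ ^ (-(1 : ℝ) / 4) * A₂⁻¹) *
        ((√n₁ + √n₂) ^ lam * |n₁ - n₂| ^ (-lam))
      = n₁ ^ (-(1 : ℝ) / 4) * n₂ ^ (-(1 : ℝ) / 4) * (√n₁ + √n₂) ^ lam * (A₁⁻¹ * A₂⁻¹) *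
        |n₁ - n₂| ^ (-lam) := by ring
    _ ≤ n₁ ^ (-(1 : ℝ) / 4) * (κ * n₁ ^ (-(1 : ℝ) / 4)) * ((1 + κ) * n₁ ^ (lam / 2)) *
        (κ * ((h₂ : ℝ) / h₁) * (r₁ : ℝ) ^ (-2 : ℝ)) * |n₁ - n₂| ^ (-lam) := by gcongr
    _ = κ ^ 2 * (1 + κ) * (n₁ ^ (-(1 : ℝ) / 4) * n₁ ^ (-(1 : ℝ) / 4) * n₁ ^ (lam / 2)) *
        ((h₂ : ℝ) / h₁) * (r₁ : ℝ) ^ (-2 : ℝ) * |n₁ - n₂| ^ (-lam) := by ring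
    _ = κ ^ 2 * (1 + κ) * n₁ ^ (-(1 - lam) / 2) *
        ((h₂ : ℝ) / h₁) * (r₁ : ℝ) ^ (-2 : ℝ) * |n₁ - n₂| ^ (-lam) := by
        rw [← Real.rpow_add N1, ← Real.rpow_add N1]
        congr 5; ring
    _ ≤ κ ^ 2 * (1 + κ) * (θ ^ (-(1 - lam) / 2) * (h₁ : ℝ) ^ (-(1 - lam))) *
        ((h₂ : ℝ) / h₁) * (r₁ : ℝ) ^ (-2 : ℝ) * |n₁ - n₂| ^ (-lam) := by gcongr
    _ = _ := by rw [hκ]; ring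

lemma one_div_abs_sub_le {s t : ℝ} (hs : 0 < s) (ht : 0 < t) (hne : s ≠ t) :
    1 / |s - t| ≤ 2 * ((√s * √t)⁻¹ + √s * √t / |s ^ 2 - t ^ 2|) := by
  have key : ∀ s t : ℝ, 0 < t → t < s →
      1 / |s - t| ≤ 2 * ((√s * √t)⁻¹ + √s * √t / |s ^ 2 - t ^ 2|) := by
    intro s t ht hts
    have hs : 0 < s := ht.trans hts
    have h1 : 0 < s - t := sub_pos.2 hts
    have h2 : 0 < s ^ 2 - t ^ 2 := by nlinarith
    rw [abs_of_pos h1, abs_of_pos h2]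
    set y := √s * √t with hy
    have hy0 : 0 < y := by positivity
    have hy2 : y ^ 2 = s * t := by
      rw [hy, mul_pow, Real.sq_sqrt hs.le, Real.sq_sqrt ht.le]
    have hy1 : y ≤ (s + t) / 2 := by
      refine abs_le_of_sq_le_sq' ?_ (by positivity) |>.2
      nlinarith [sq_nonneg (s - t)]
    rw [show 2 * (y⁻¹ + y / (s ^ 2 - t ^ 2)) = 2 * ((s ^ 2 - t ^ 2) + y ^ 2) /
      (y * (s ^ 2 - t ^ 2)) by field_simp, div_le_div_iff₀ h1 (by positivity), hy2]
    have h3 : y * (s + t) ≤ 2 * (s ^ 2 - t ^ 2 + s * t) := by nlinarith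
    nlinarith
  rcases lt_or_gt_of_ne hne with h | h
  · have := key t s hs h
    rwa [abs_sub_comm, abs_sub_comm (t ^ 2), mul_comm (√t)] at this
  · exact key s t ht h

lemma weight_mul_le_of_far (hθ : 0 < θ) (hh₁ : 0 < h₁) (hh₂ : 0 < h₂) (hr₁ : θ * h₁ < r₁)
    (hr₂ : θ * h₂ < r₂) (hfar : 1 ≤ |freq θ h₁ r₁ - freq θ h₂ r₂|) :
    weight θ h₁ r₁ * weight θ h₂ r₂ * (1 / |√(freq θ h₁ r₁) - √(freq θ h₂ r₂)|) ≤
      2 * (((h₁ : ℝ) ^ (-(1 : ℝ) / 2) * (2 * (r₁ : ℝ) - θ * h₁) ^ (-(3 : ℝ) / 2)) *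
        ((h₂ : ℝ) ^ (-(1 : ℝ) / 2) * (2 * (r₂ : ℝ) - θ * h₂) ^ (-(3 : ℝ) / 2))) +
      6 * ((2 * (r₁ : ℝ) - θ * h₁)⁻¹ * (2 * (r₂ : ℝ) - θ * h₂)⁻¹ /
        (1 + |((⌊freq θ h₁ r₁⌋₊ : ℕ) : ℝ) - (⌊freq θ h₂ r₂⌋₊ : ℕ)|)) := by
  have N1 := freq_pos hθ hh₁ hr₁
  have N2 := freq_pos hθ hh₂ hr₂
  have hy : ∀ h r : ℕ, 0 < h → θ * h < r →
      (h : ℝ) ^ (-(1 : ℝ) / 2) * (2 * (r : ℝ) - θ * h) ^ (-(3 : ℝ) / 2) =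
        freq θ h r ^ (-(1 : ℝ) / 2) * (2 * (r : ℝ) - θ * h)⁻¹ := by
    intro h r hh hr
    have h2 := two_mul_sub_pos hθ hr
    unfold freq
    rw [Real.mul_rpow (by positivity) h2.le, ← Real.rpow_neg_one (2 * (r : ℝ) - θ * h), mul_assoc,
      ← Real.rpow_add h2]
    norm_num
  rw [hy h₁ r₁ hh₁ hr₁, hy h₂ r₂ hh₂ hr₂, weight_eq hθ hr₁, weight_eq hθ hr₂]
  have a1 := two_mul_sub_pos hθ hr₁
  have a2 := two_mul_sub_pos hθ hr₂
  set A₁ := 2 * (r₁ : ℝ) - θ * h₁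
  set A₂ := 2 * (r₂ : ℝ) - θ * h₂
  set n₁ := freq θ h₁ r₁
  set n₂ := freq θ h₂ r₂
  have hne : √n₁ ≠ √n₂ := by
    intro h
    rw [Real.sqrt_inj N1.le N2.le] at h
    rw [h, sub_self, abs_zero] at hfar
    linarith
  have hk := one_div_abs_sub_le (Real.sqrt_pos.2 N1) (Real.sqrt_pos.2 N2) hne
  rw [Real.sq_sqrt N1.le, Real.sq_sqrt N2.le] at hk
  have q : ∀ n : ℝ, 0 < n → √√n = n ^ ((1 : ℝ) / 4) := by
    intro n hn
    rw [Real.sqrt_eq_rpow, Real.sqrt_eq_rpow, ← Real.rpow_mul hn.le]; norm_num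
  rw [q _ N1, q _ N2] at hk
  have hfl : 1 / |n₁ - n₂| ≤ 3 / (1 + |((⌊n₁⌋₊ : ℕ) : ℝ) - (⌊n₂⌋₊ : ℕ)|) := by
    rw [div_le_div_iff₀ (by linarith) (by positivity)]
    have f1 := Nat.floor_le N1.le
    have f2 := Nat.floor_le N2.le
    have f3 := Nat.lt_floor_add_one n₁
    have f4 := Nat.lt_floor_add_one n₂
    have f5 : |((⌊n₁⌋₊ : ℕ) : ℝ) - (⌊n₂⌋₊ : ℕ)| ≤ |n₁ - n₂| + 1 := by
      rw [abs_le]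
      constructor <;> linarith [neg_abs_le (n₁ - n₂), le_abs_self (n₁ - n₂)]
    linarith
  have c1 : n₁ ^ (-(1 : ℝ) / 4) * n₁ ^ ((1 : ℝ) / 4) = 1 := by
    rw [← Real.rpow_add N1]; norm_num
  have c2 : n₂ ^ (-(1 : ℝ) / 4) * n₂ ^ ((1 : ℝ) / 4) = 1 := by
    rw [← Real.rpow_add N2]; norm_num
  have d : ∀ n : ℝ, 0 < n → n ^ (-(1 : ℝ) / 4) * (n ^ ((1 : ℝ) / 4))⁻¹ = n ^ (-(1 : ℝ) / 2) := by
    intro n hn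
    rw [← Real.rpow_neg hn.le, ← Real.rpow_add hn]; norm_num
  calc n₁ ^ (-(1 : ℝ) / 4) * A₁⁻¹ * (n₂ ^ (-(1 : ℝ) / 4) * A₂⁻¹) * (1 / |√n₁ - √n₂|)
      ≤ n₁ ^ (-(1 : ℝ) / 4) * A₁⁻¹ * (n₂ ^ (-(1 : ℝ) / 4) * A₂⁻¹) *
        (2 * ((n₁ ^ ((1 : ℝ) / 4) * n₂ ^ ((1 : ℝ) / 4))⁻¹ +
          n₁ ^ ((1 : ℝ) / 4) * n₂ ^ ((1 : ℝ) / 4) / |n₁ - n₂|)) := by gcongr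
    _ = 2 * ((n₁ ^ (-(1 : ℝ) / 4) * (n₁ ^ ((1 : ℝ) / 4))⁻¹) * A₁⁻¹ *
          ((n₂ ^ (-(1 : ℝ) / 4) * (n₂ ^ ((1 : ℝ) / 4))⁻¹) * A₂⁻¹)) +
        2 * (A₁⁻¹ * A₂⁻¹) * ((n₁ ^ (-(1 : ℝ) / 4) * n₁ ^ ((1 : ℝ) / 4)) *
          (n₂ ^ (-(1 : ℝ) / 4) * n₂ ^ ((1 : ℝ) / 4))) * (1 / |n₁ - n₂|) := by
        rw [mul_inv]; ring
    _ = 2 * (n₁ ^ (-(1 : ℝ) / 2) * A₁⁻¹ * (n₂ ^ (-(1 : ℝ) / 2) * A₂⁻¹)) +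
        2 * (A₁⁻¹ * A₂⁻¹) * (1 / |n₁ - n₂|) := by
        rw [c1, c2, d _ N1, d _ N2]; ring
    _ ≤ 2 * (n₁ ^ (-(1 : ℝ) / 2) * A₁⁻¹ * (n₂ ^ (-(1 : ℝ) / 2) * A₂⁻¹)) +
        2 * (A₁⁻¹ * A₂⁻¹) * (3 / (1 + |((⌊n₁⌋₊ : ℕ) : ℝ) - (⌊n₂⌋₊ : ℕ)|)) := by gcongr
    _ = _ := by ring

end Pointwise

lemma sum_Icc_comm_le (F : ℕ → ℕ → ℝ) (hF : ∀ a b, 0 ≤ F a b) (hsymm : ∀ a b, F a b = F b a)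
    (H : ℕ) :
    ∑ a ∈ Finset.Icc 1 H, ∑ b ∈ Finset.Icc 1 H, F a b ≤
      2 * ∑ a ∈ Finset.Icc 1 H, ∑ b ∈ Finset.Icc 1 a, F a b := by
  have h1 : ∀ a ∈ Finset.Icc 1 H, ∑ b ∈ Finset.Icc 1 H, (if b ≤ a then F a b else 0) =
      ∑ b ∈ Finset.Icc 1 a, F a b := by
    intro a ha
    rw [← Finset.sum_filter]
    congr 1
    ext b
    simp only [Finset.mem_filter, Finset.mem_Icc] at ha ⊢
    omega
  have h2 : ∑ a ∈ Finset.Icc 1 H, ∑ b ∈ Finset.Icc 1 H, (if a ≤ b then F a b else 0) =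
      ∑ a ∈ Finset.Icc 1 H, ∑ b ∈ Finset.Icc 1 a, F a b := by
    rw [Finset.sum_comm, ← Finset.sum_congr rfl h1]
    simp only [hsymm]
  calc _ ≤ ∑ a ∈ Finset.Icc 1 H, ∑ b ∈ Finset.Icc 1 H,
        ((if b ≤ a then F a b else 0) + if a ≤ b then F a b else 0) := by
        refine Finset.sum_le_sum fun a _ => Finset.sum_le_sum fun b _ => ?_
        have := hF a b
        rcases le_total a b with h | h
        · simp only [h, if_true]; split_ifs <;> linarith
        · simp only [h, if_true]; split_ifs <;> linarith
    _ = _ := by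
        simp only [Finset.sum_add_distrib]
        rw [h2, Finset.sum_congr rfl h1]; ring

/-- For fixed `h₁, h₂`, the pairs `(r₁, r₂)` with close frequencies have `r₁` in a single
residue class modulo `h₂ / gcd(h₁, h₂)`. -/
lemma sum_close_le {θ e : ℝ} (hθ : 0 < θ) (he : 0 < e) (he1 : e ≤ 1 / 2) {h₁ h₂ : ℕ}
    (hh₂ : 0 < h₂) (hle : h₂ ≤ h₁) (I₁ I₂ : Finset ℕ) (hI : ∀ r ∈ I₁, θ * h₁ < (r : ℝ)) :
    ∑ r₁ ∈ I₁, ∑ r₂ ∈ I₂, (if |freq θ h₁ r₁ - freq θ h₂ r₂| < 1 then (r₁ : ℝ) ^ (-2 : ℝ) else 0) ≤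
      (θ ^ (-1 + e) * (min 1 θ) ^ (-1 - e) * pSeries e) *
        ((h₁.gcd h₂ : ℝ) / h₂ * (h₁ : ℝ) ^ (-1 + e)) := by
  have hh₁ : 0 < h₁ := hh₂.trans_le hle
  have H1 : (0 : ℝ) < h₁ := by exact_mod_cast hh₁
  have H2 : (0 : ℝ) < h₂ := by exact_mod_cast hh₂
  set P : ℕ → ℕ → Prop := fun r₁ r₂ => |freq θ h₁ r₁ - freq θ h₂ r₂| < 1 with hP
  have hcongr : ∀ r₁ r₂ r₁' r₂' : ℕ, P r₁ r₂ → P r₁' r₂' →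
      (h₁ * r₁ - h₂ * r₂ : ℤ) = h₁ * r₁' - h₂ * r₂' := by
    intro r₁ r₂ r₁' r₂' h h'
    simp only [hP, freq_sub_freq] at h h'
    rw [abs_lt] at h h'
    have k1 : ((h₁ * r₁ - h₂ * r₂ : ℤ) : ℝ) < ((h₁ * r₁' - h₂ * r₂' : ℤ) : ℝ) + 1 := by linarith
    have k2 : ((h₁ * r₁' - h₂ * r₂' : ℤ) : ℝ) < ((h₁ * r₁ - h₂ * r₂ : ℤ) : ℝ) + 1 := by linarith
    have k3 : (h₁ * r₁ - h₂ * r₂ : ℤ) < (h₁ * r₁' - h₂ * r₂' : ℤ) + 1 := by exact_mod_cast k1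
    have k4 : (h₁ * r₁' - h₂ * r₂' : ℤ) < (h₁ * r₁ - h₂ * r₂ : ℤ) + 1 := by exact_mod_cast k2
    omega
  classical
  set R := I₁.filter fun r₁ => ∃ r₂ ∈ I₂, P r₁ r₂ with hR
  have hstep : ∑ r₁ ∈ I₁, ∑ r₂ ∈ I₂, (if P r₁ r₂ then (r₁ : ℝ) ^ (-2 : ℝ) else 0) ≤
      ∑ r₁ ∈ R, (r₁ : ℝ) ^ (-2 : ℝ) := by
    rw [hR, Finset.sum_filter]
    refine Finset.sum_le_sum fun r₁ _ => ?_
    split_ifs with hex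
    · rw [← Finset.sum_filter, Finset.sum_const, nsmul_eq_mul]
      have hcard : (I₂.filter fun r₂ => P r₁ r₂).card ≤ 1 := by
        rw [Finset.card_le_one]
        intro a ha b hb
        rw [Finset.mem_filter] at ha hb
        have h3 := hcongr _ _ _ _ ha.2 hb.2
        have h4 : (h₂ : ℤ) * a = h₂ * b := by linarith
        exact_mod_cast mul_left_cancel₀ (by exact_mod_cast hh₂.ne') h4
      have hcard' : ((I₂.filter fun r₂ => P r₁ r₂).card : ℝ) ≤ 1 := by exact_mod_cast hcard
      exact mul_le_of_le_one_left (by positivity) hcard'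
    · refine (Finset.sum_eq_zero fun r₂ hr₂ => ?_).le
      rw [if_neg fun h => hex ⟨r₂, hr₂, h⟩]
  set g := h₁.gcd h₂ with hg
  have hg0 : 0 < g := Nat.gcd_pos_of_pos_left _ hh₁
  have G0 : (0 : ℝ) < g := by exact_mod_cast hg0
  set b := h₂ / g with hb
  have hb0 : 0 < b := Nat.div_pos (Nat.gcd_le_right _ hh₂) hg0
  have B0 : (1 : ℝ) ≤ b := by exact_mod_cast hb0
  have hbr : (b : ℝ) = h₂ / g := by
    rw [hb, Nat.cast_div (Nat.gcd_dvd_right _ _) G0.ne']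
  have hbh : (b : ℝ) ≤ h₁ := by exact_mod_cast (Nat.div_le_self _ _).trans hle
  have hq0 : 0 < min 1 θ := lt_min one_pos hθ
  have hsep := sum_rpow_le_of_separated he (q := min 1 θ * b) (by positivity) R
    (by
      intro n hn
      rw [hR, Finset.mem_filter] at hn
      have h3 := hI n hn.1
      have h4 : min 1 θ * b ≤ θ * h₁ := by
        gcongr
        exact min_le_right _ _
      linarith)
    (by
      intro n hn n' hn' hlt
      rw [hR, Finset.mem_filter] at hn hn'
      obtain ⟨_, m, _, hm⟩ := hn
      obtain ⟨_, m', _, hm'⟩ := hn'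
      have h3 := hcongr _ _ _ _ hm hm'
      have h4 : (h₁ : ℤ) * ((n' - n : ℕ) : ℤ) = h₂ * (m' - m) := by
        push_cast [Nat.cast_sub hlt.le]; linarith
      have h5 : h₂ ∣ h₁ * (n' - n) := by
        rw [← Int.natCast_dvd_natCast]
        push_cast
        exact ⟨_, h4⟩
      have h6 : b ∣ (h₁ / g) * (n' - n) := by
        have : g * b ∣ g * ((h₁ / g) * (n' - n)) := by
          rw [← mul_assoc, hb, Nat.mul_div_cancel' (Nat.gcd_dvd_right _ _),
            Nat.mul_div_cancel' (Nat.gcd_dvd_left _ _)]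
          exact h5
        exact Nat.dvd_of_mul_dvd_mul_left hg0 this
      have h7 : b ∣ n' - n :=
        (Nat.coprime_div_gcd_div_gcd (m := h₁) (n := h₂) hg0).symm.dvd_of_dvd_mul_left h6
      have h8 : b ≤ n' - n := Nat.le_of_dvd (Nat.sub_pos_of_lt hlt) h7
      rw [← Nat.cast_sub hlt.le]
      calc min 1 θ * (b : ℝ) ≤ 1 * b := by gcongr; exact min_le_left _ _
        _ ≤ _ := by rw [one_mul]; exact_mod_cast h8)
  have hZ := one_le_pSeries he
  calc _ ≤ ∑ r₁ ∈ R, (r₁ : ℝ) ^ (-2 : ℝ) := hstep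
    _ ≤ ∑ r₁ ∈ R, (θ * h₁) ^ (-1 + e) * (r₁ : ℝ) ^ (-1 - e) := by
        refine Finset.sum_le_sum fun r hr => ?_
        rw [hR, Finset.mem_filter] at hr
        have h3 := hI r hr.1
        have h4 : 0 < θ * h₁ := by positivity
        rw [show (-2 : ℝ) = (-1 + e) + (-1 - e) by ring, Real.rpow_add (h4.trans h3)]
        gcongr ?_ * _
        exact Real.rpow_le_rpow_of_nonpos h4 h3.le (by linarith)
    _ = (θ * h₁) ^ (-1 + e) * ∑ r₁ ∈ R, (r₁ : ℝ) ^ (-1 - e) := by rw [Finset.mul_sum]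
    _ ≤ (θ * h₁) ^ (-1 + e) * ((min 1 θ * b) ^ (-1 - e) * pSeries e) := by gcongr
    _ = (θ ^ (-1 + e) * (min 1 θ) ^ (-1 - e) * pSeries e) *
        ((b : ℝ) ^ (-1 - e) * (h₁ : ℝ) ^ (-1 + e)) := by
        rw [Real.mul_rpow hθ.le H1.le, Real.mul_rpow hq0.le (by positivity)]; ring
    _ ≤ _ := by
        gcongr
        calc (b : ℝ) ^ (-1 - e) ≤ (b : ℝ) ^ (-1 : ℝ) :=
              Real.rpow_le_rpow_of_exponent_le B0 (by linarith)
          _ = _ := by rw [Real.rpow_neg_one, hbr, inv_div]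

lemma half_gcd_mul_le {h₁ h₂ : ℕ} (hh₂ : 0 < h₂) (hle : h₂ ≤ h₁) :
    (h₁.gcd h₂ : ℝ) * ((h₁ + h₂) / h₁.gcd h₂ : ℕ) / 2 ≤ h₁ ∧
      0 < (h₁.gcd h₂ : ℝ) * ((h₁ + h₂) / h₁.gcd h₂ : ℕ) / 2 := by
  have h := Nat.mul_div_cancel' (Nat.dvd_add (Nat.gcd_dvd_left h₁ h₂) (Nat.gcd_dvd_right h₁ h₂))
  have h' : (h₁.gcd h₂ : ℝ) * ((h₁ + h₂) / h₁.gcd h₂ : ℕ) = h₁ + h₂ := by exact_mod_cast h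
  have h3 : (h₂ : ℝ) ≤ h₁ := by exact_mod_cast hle
  have h4 : (0 : ℝ) < h₂ := by exact_mod_cast hh₂
  rw [h']
  constructor <;> linarith

lemma exists_sum_inv_close_le {θ e : ℝ} (hθ : 0 < θ) (he : 0 < e) (he1 : e ≤ 1 / 2) :
    ∃ C : ℝ, 0 < C ∧ ∀ (H : ℕ) (I : ℕ → Finset ℕ), (∀ h, ∀ r ∈ I h, θ * h < (r : ℝ)) →
      ∑ h₁ ∈ Finset.Icc 1 H, ∑ h₂ ∈ Finset.Icc 1 H, ∑ r₁ ∈ I h₁, ∑ r₂ ∈ I h₂,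
        (if |freq θ h₁ r₁ - freq θ h₂ r₂| < 1 then
          (2 * (r₁ : ℝ) - θ * h₁)⁻¹ * (2 * (r₂ : ℝ) - θ * h₂)⁻¹ else 0) ≤
      C * (H : ℝ) ^ (4 * e) := by
  have hZ := one_le_pSeries he
  have hq0 : 0 < min 1 θ := lt_min one_pos hθ
  set C₁ := θ ^ (-1 + e) * (min 1 θ) ^ (-1 - e) * pSeries e with hC₁
  have hC₁0 : 0 < C₁ := by positivity
  set C₂ := (1 + 1 / θ) * C₁ * (1 / 2 : ℝ) ^ (-2 + e) with hC₂
  have hC₂0 : 0 < C₂ := by positivity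
  refine ⟨2 * (C₂ * (2 * pSeries e ^ 2 * 2 ^ (2 * e))), by positivity, fun H I hI => ?_⟩
  refine (sum_Icc_comm_le (fun h₁ h₂ => ∑ r₁ ∈ I h₁, ∑ r₂ ∈ I h₂,
        (if |freq θ h₁ r₁ - freq θ h₂ r₂| < 1 then
          (2 * (r₁ : ℝ) - θ * h₁)⁻¹ * (2 * (r₂ : ℝ) - θ * h₂)⁻¹ else 0)) ?_ ?_ H).trans ?_
  · intro a b
    refine Finset.sum_nonneg fun r₁ hr₁ => Finset.sum_nonneg fun r₂ hr₂ => ?_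
    have a1 := two_mul_sub_pos hθ (hI _ _ hr₁)
    have a2 := two_mul_sub_pos hθ (hI _ _ hr₂)
    split_ifs <;> positivity
  · intro a b
    rw [Finset.sum_comm]
    refine Finset.sum_congr rfl fun r₁ _ => Finset.sum_congr rfl fun r₂ _ => ?_
    rw [abs_sub_comm, mul_comm]
  rw [mul_assoc]
  gcongr
  set f : ℕ → ℕ → ℕ → ℝ := fun g m n =>
    if m ≤ n then C₂ * ((g : ℝ) ^ (-1 + e) * (n : ℝ) ^ (-2 + e)) else 0 with hf
  have hf0 : ∀ g m n, 0 ≤ f g m n := by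
    intro g m n; simp only [hf]; split_ifs <;> positivity
  have hpt : ∀ h₁ ∈ Finset.Icc 1 H, ∀ h₂ ∈ Finset.Icc 1 h₁, ∑ r₁ ∈ I h₁, ∑ r₂ ∈ I h₂,
        (if |freq θ h₁ r₁ - freq θ h₂ r₂| < 1 then
          (2 * (r₁ : ℝ) - θ * h₁)⁻¹ * (2 * (r₂ : ℝ) - θ * h₂)⁻¹ else 0) ≤
      f (h₁.gcd h₂) ((h₁ - h₂) / h₁.gcd h₂) ((h₁ + h₂) / h₁.gcd h₂) := by
    intro h₁ hh₁ h₂ hh₂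
    rw [Finset.mem_Icc] at hh₁ hh₂
    have H1 : (0 : ℝ) < h₁ := by exact_mod_cast hh₁.1
    have H2 : (0 : ℝ) < h₂ := by exact_mod_cast hh₂.1
    have hclose := sum_close_le hθ he he1 hh₂.1 hh₂.2 (I h₁) (I h₂) (hI h₁)
    obtain ⟨g1, g2⟩ := half_gcd_mul_le hh₂.1 hh₂.2
    have hG : (0 : ℝ) < h₁.gcd h₂ := by exact_mod_cast Nat.gcd_pos_of_pos_left _ hh₁.1
    simp only [hf]
    rw [if_pos (Nat.div_le_div_right (by omega))]
    calc _ ≤ ∑ r₁ ∈ I h₁, ∑ r₂ ∈ I h₂, (1 + 1 / θ) * ((h₂ : ℝ) / h₁) *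
          (if |freq θ h₁ r₁ - freq θ h₂ r₂| < 1 then (r₁ : ℝ) ^ (-2 : ℝ) else 0) := by
          refine Finset.sum_le_sum fun r₁ hr₁ => Finset.sum_le_sum fun r₂ hr₂ => ?_
          split_ifs with hc
          · exact inv_mul_inv_le_of_close hθ hh₁.1 hh₂.1 (hI _ _ hr₁) (hI _ _ hr₂) hc
          · simp
      _ = (1 + 1 / θ) * ((h₂ : ℝ) / h₁) * ∑ r₁ ∈ I h₁, ∑ r₂ ∈ I h₂,
          (if |freq θ h₁ r₁ - freq θ h₂ r₂| < 1 then (r₁ : ℝ) ^ (-2 : ℝ) else 0) := by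
          simp only [Finset.mul_sum]
      _ ≤ (1 + 1 / θ) * ((h₂ : ℝ) / h₁) * (C₁ * ((h₁.gcd h₂ : ℝ) / h₂ * (h₁ : ℝ) ^ (-1 + e))) := by
          gcongr
      _ = (1 + 1 / θ) * C₁ * (h₁.gcd h₂ * (h₁ : ℝ) ^ (-2 + e)) := by
          rw [show (-2 + e) = (-1 + e) - 1 by ring, Real.rpow_sub_one H1.ne']
          field_simp
      _ ≤ (1 + 1 / θ) * C₁ * (h₁.gcd h₂ *
          ((h₁.gcd h₂ : ℝ) * ((h₁ + h₂) / h₁.gcd h₂ : ℕ) / 2) ^ (-2 + e)) := by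
          gcongr _ * (_ * ?_)
          exact Real.rpow_le_rpow_of_nonpos g2 g1 (by linarith)
      _ = _ := by
          rw [div_eq_mul_one_div (_ * _) (2 : ℝ), Real.mul_rpow (by positivity) (by positivity),
            Real.mul_rpow (by positivity) (by positivity), hC₂,
            show (-1 + e) = 1 + (-2 + e) by ring, Real.rpow_add hG 1, Real.rpow_one]
          ring
  calc _ ≤ ∑ h₁ ∈ Finset.Icc 1 H, ∑ h₂ ∈ Finset.Icc 1 h₁,
        f (h₁.gcd h₂) ((h₁ - h₂) / h₁.gcd h₂) ((h₁ + h₂) / h₁.gcd h₂) :=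
        Finset.sum_le_sum fun h₁ hh₁ => Finset.sum_le_sum fun h₂ hh₂ => hpt h₁ hh₁ h₂ hh₂
    _ ≤ _ := sum_gcd_le f hf0 H
    _ ≤ ∑ g ∈ Finset.Icc 1 H, ∑ n ∈ Finset.Icc 1 (2 * H),
          C₂ * 2 * ((g : ℝ) ^ (-1 + e) * (n : ℝ) ^ (-1 + e)) := by
        refine Finset.sum_le_sum fun g _ => ?_
        rw [Finset.sum_comm]
        refine Finset.sum_le_sum fun n hn => ?_
        rw [Finset.mem_Icc] at hn
        have hn1 : (1 : ℝ) ≤ n := by exact_mod_cast hn.1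
        simp only [hf]
        rw [← Finset.sum_filter, Finset.sum_const, nsmul_eq_mul]
        have hcard : ((Finset.range (2 * H + 1)).filter (· ≤ n)).card ≤ n + 1 := by
          calc _ ≤ (Finset.range (n + 1)).card := by
                refine Finset.card_le_card fun m hm => ?_
                rw [Finset.mem_filter] at hm
                rw [Finset.mem_range]; omega
            _ = n + 1 := Finset.card_range _
        have hcard' : (((Finset.range (2 * H + 1)).filter (· ≤ n)).card : ℝ) ≤ 2 * n := by
          have : (((Finset.range (2 * H + 1)).filter (· ≤ n)).card : ℝ) ≤ (n : ℝ) + 1 := by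
            exact_mod_cast hcard
          linarith
        calc _ ≤ 2 * (n : ℝ) * (C₂ * ((g : ℝ) ^ (-1 + e) * (n : ℝ) ^ (-2 + e))) := by gcongr
          _ = _ := by
            rw [show (n : ℝ) ^ (-1 + e) = n * (n : ℝ) ^ (-2 + e) by
              rw [show (-1 + e) = 1 + (-2 + e) by ring, Real.rpow_add (by linarith) 1,
                Real.rpow_one]]
            ring
    _ = C₂ * 2 * ((∑ g ∈ Finset.Icc 1 H, (g : ℝ) ^ (-1 + e)) *
          ∑ n ∈ Finset.Icc 1 (2 * H), (n : ℝ) ^ (-1 + e)) := by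
        rw [Finset.sum_mul_sum]; simp only [Finset.mul_sum]
    _ ≤ C₂ * 2 * (((H : ℝ) ^ (e + e) * pSeries e) * (((2 * H : ℕ) : ℝ) ^ (e + e) * pSeries e)) := by
        gcongr
        · exact sum_Icc_rpow_le he (by linarith) H
        · exact sum_Icc_rpow_le he (by linarith) (2 * H)
    _ = _ := by
        push_cast
        rw [← two_mul e, Real.mul_rpow (by norm_num) (by positivity),
          show 4 * e = 2 * e + 2 * e by ring, Real.rpow_add_of_nonneg (x := (H : ℝ))
          (by positivity) (by positivity) (by positivity)]
        ring

lemma two_mul_gcd_mul_distInt_le (θ : ℝ) {h₁ h₂ : ℕ} (hle : h₂ ≤ h₁) (r₁ r₂ : ℕ) :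
    2 * (h₁.gcd h₂ : ℝ) * distInt (θ / 2 *
        (h₁.gcd h₂ * ((h₁ - h₂) / h₁.gcd h₂) * ((h₁ + h₂) / h₁.gcd h₂) : ℕ)) ≤
      |freq θ h₁ r₁ - freq θ h₂ r₂| := by
  set g := h₁.gcd h₂ with hg
  have hm := Nat.mul_div_cancel' (Nat.dvd_sub (Nat.gcd_dvd_left h₁ h₂) (Nat.gcd_dvd_right h₁ h₂))
  have hn := Nat.mul_div_cancel' (Nat.dvd_add (Nat.gcd_dvd_left h₁ h₂) (Nat.gcd_dvd_right h₁ h₂))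
  have ha := Nat.mul_div_cancel' (Nat.gcd_dvd_left h₁ h₂)
  have hb := Nat.mul_div_cancel' (Nat.gcd_dvd_right h₁ h₂)
  rw [← hg] at hm hn ha hb
  set m := (h₁ - h₂) / g
  set n := (h₁ + h₂) / g
  set a := h₁ / g
  set b := h₂ / g
  have hm' : (g : ℝ) * m = h₁ - h₂ := by
    rw [← Nat.cast_sub hle]; exact_mod_cast hm
  have hn' : (g : ℝ) * n = h₁ + h₂ := by exact_mod_cast hn
  have ha' : (g : ℝ) * a = h₁ := by exact_mod_cast ha
  have hb' : (g : ℝ) * b = h₂ := by exact_mod_cast hb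
  have key : freq θ h₁ r₁ - freq θ h₂ r₂ =
      -(2 * (g : ℝ) * (θ / 2 * (g * m * n : ℕ) - ((a * r₁ - b * r₂ : ℤ) : ℝ))) := by
    rw [freq_sub_freq]
    have h1 : ((h₁ : ℝ) ^ 2 - (h₂ : ℝ) ^ 2) = (g * m) * (g * n) := by rw [hm', hn']; ring
    push_cast
    rw [h1, ← ha', ← hb']
    ring
  rw [key, abs_neg, abs_mul, abs_of_nonneg (by positivity : (0 : ℝ) ≤ 2 * g)]
  gcongr
  exact round_le _ _

lemma exists_sum_weight_close_le {θ γ lam c e : ℝ} (hθ : 0 < θ) (hγ : 0 < γ) (hc : 0 < c)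
    (he : 0 < e) (hlam : 0 < lam) (hlam1 : lam ≤ 1 / 2) (hγlam : γ * lam < 1 - lam + e)
    (hle : e ≤ lam / 2)
    (hα : ∀ q : ℕ, 0 < q → ∀ z : ℤ, c * (q : ℝ) ^ (-γ) ≤ |θ / 2 * q - z|) :
    ∃ C : ℝ, 0 < C ∧ ∀ (H : ℕ) (I : ℕ → Finset ℕ), (∀ h, ∀ r ∈ I h, θ * h < (r : ℝ)) →
      ∑ h₁ ∈ Finset.Icc 1 H, ∑ h₂ ∈ Finset.Icc 1 H, ∑ r₁ ∈ I h₁, ∑ r₂ ∈ I h₂,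
        (if freq θ h₁ r₁ ≠ freq θ h₂ r₂ ∧ |freq θ h₁ r₁ - freq θ h₂ r₂| < 1 then
          weight θ h₁ r₁ * weight θ h₂ r₂ *
            (1 / |√(freq θ h₁ r₁) - √(freq θ h₂ r₂)|) ^ lam else 0) ≤
      C * (H : ℝ) ^ (5 * e) := by
  have hZ := one_le_pSeries he
  have hq0 : 0 < min 1 θ := lt_min one_pos hθ
  obtain ⟨C₀, hC₀0, hC₀⟩ := exists_sum_distInt_rpow_le (α := θ / 2) (s := 1 - lam + e)
    hc hγ he hlam hγlam (by linarith) hα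
  set C₁ := θ ^ (-1 + e) * (min 1 θ) ^ (-1 - e) * pSeries e with hC₁
  have hC₁0 : 0 < C₁ := by positivity
  set K := (1 + 1 / θ) ^ 2 * (2 + 1 / θ) * θ ^ (-(1 - lam) / 2) with hK
  have hK0 : 0 < K := by positivity
  set C₂ := K * C₁ * (1 / 2 : ℝ) ^ (-3 + lam + e) with hC₂
  have hC₂0 : 0 < C₂ := by positivity
  refine ⟨2 * (C₂ * C₀ * (pSeries e ^ 2 * 2 ^ (4 * e))), by positivity, fun H I hI => ?_⟩
  refine (sum_Icc_comm_le (fun h₁ h₂ => ∑ r₁ ∈ I h₁, ∑ r₂ ∈ I h₂,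
        (if freq θ h₁ r₁ ≠ freq θ h₂ r₂ ∧ |freq θ h₁ r₁ - freq θ h₂ r₂| < 1 then
          weight θ h₁ r₁ * weight θ h₂ r₂ *
            (1 / |√(freq θ h₁ r₁) - √(freq θ h₂ r₂)|) ^ lam else 0)) ?_ ?_ H).trans ?_
  · intro a b
    refine Finset.sum_nonneg fun r₁ hr₁ => Finset.sum_nonneg fun r₂ hr₂ => ?_
    have a1 := two_mul_sub_pos hθ (hI _ _ hr₁)
    have a2 := two_mul_sub_pos hθ (hI _ _ hr₂)
    unfold weight
    split_ifs <;> positivity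
  · intro a b
    rw [Finset.sum_comm]
    refine Finset.sum_congr rfl fun r₁ _ => Finset.sum_congr rfl fun r₂ _ => ?_
    rw [abs_sub_comm, abs_sub_comm (√_), mul_comm (weight θ a _)]
    exact if_congr (and_congr_left' ne_comm) rfl rfl
  rw [mul_assoc]
  gcongr
  set f : ℕ → ℕ → ℕ → ℝ := fun g m n =>
    C₂ * ((g : ℝ) ^ (-2 + e) * (m : ℝ) ^ (-2 + lam + 2 * e) *
      ((n : ℝ) ^ (-1 - e) * distInt (θ / 2 * (g * m * n : ℕ)) ^ (-lam))) with hf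
  have hd0 : ∀ x, 0 ≤ distInt x := distInt_nonneg
  have hf0 : ∀ g m n, 0 ≤ f g m n := by
    intro g m n
    have := hd0 (θ / 2 * (g * m * n : ℕ))
    simp only [hf]; positivity
  have hpt : ∀ h₁ ∈ Finset.Icc 1 H, ∀ h₂ ∈ Finset.Icc 1 h₁, ∑ r₁ ∈ I h₁, ∑ r₂ ∈ I h₂,
        (if freq θ h₁ r₁ ≠ freq θ h₂ r₂ ∧ |freq θ h₁ r₁ - freq θ h₂ r₂| < 1 then
          weight θ h₁ r₁ * weight θ h₂ r₂ *
            (1 / |√(freq θ h₁ r₁) - √(freq θ h₂ r₂)|) ^ lam else 0) ≤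
      f (h₁.gcd h₂) ((h₁ - h₂) / h₁.gcd h₂) ((h₁ + h₂) / h₁.gcd h₂) := by
    intro h₁ hh₁ h₂ hh₂
    rw [Finset.mem_Icc] at hh₁ hh₂
    have H1 : (0 : ℝ) < h₁ := by exact_mod_cast hh₁.1
    have H2 : (0 : ℝ) < h₂ := by exact_mod_cast hh₂.1
    rcases eq_or_ne h₁ h₂ with rfl | hne
    · refine le_trans (le_of_eq ?_) (hf0 _ _ _)
      refine Finset.sum_eq_zero fun r₁ _ => Finset.sum_eq_zero fun r₂ _ => ?_
      refine if_neg ?_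
      rintro ⟨h1, h2⟩
      have h3 : freq θ h₁ r₁ - freq θ h₁ r₂ = ((2 * (h₁ * r₁ - h₁ * r₂) : ℤ) : ℝ) := by
        rw [freq_sub_freq]; push_cast; ring
      rw [h3] at h2
      have h4 : |(2 * (h₁ * r₁ - h₁ * r₂) : ℤ)| < 1 := by exact_mod_cast h2
      rw [Int.abs_lt_one_iff] at h4
      rw [h4, Int.cast_zero, sub_eq_zero] at h3
      exact h1 h3
    have hclose := sum_close_le hθ he (by linarith) hh₂.1 hh₂.2 (I h₁) (I h₂) (hI h₁)
    obtain ⟨g1, g2⟩ := half_gcd_mul_le hh₂.1 hh₂.2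
    have hdist := two_mul_gcd_mul_distInt_le θ hh₂.2
    have hG' : 0 < h₁.gcd h₂ := Nat.gcd_pos_of_pos_left _ hh₁.1
    have hm := Nat.mul_div_cancel'
      (Nat.dvd_sub (Nat.gcd_dvd_left h₁ h₂) (Nat.gcd_dvd_right h₁ h₂))
    have hmn : (h₁ - h₂) / h₁.gcd h₂ ≤ (h₁ + h₂) / h₁.gcd h₂ :=
      Nat.div_le_div_right (by omega)
    simp only [hf]
    set g := h₁.gcd h₂
    set m := (h₁ - h₂) / g
    set n := (h₁ + h₂) / g
    have hG : (0 : ℝ) < g := by exact_mod_cast hG'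
    have hm0 : 0 < m := by
      rcases Nat.eq_zero_or_pos m with h | h
      · rw [h] at hm; omega
      · exact h
    have M0 : (0 : ℝ) < m := by exact_mod_cast hm0
    have N0 : (0 : ℝ) < n := by exact_mod_cast hm0.trans_le hmn
    have MN : (m : ℝ) ≤ n := by exact_mod_cast hmn
    set D := distInt (θ / 2 * (g * m * n : ℕ))
    have hD0 : 0 < D := by
      have hpos : 0 < g * m * n := Nat.mul_pos (Nat.mul_pos hG' hm0) (hm0.trans_le hmn)
      refine lt_of_lt_of_le ?_ (hα (g * m * n) hpos (round (θ / 2 * (g * m * n : ℕ))))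
      have : (0 : ℝ) < (g * m * n : ℕ) := by exact_mod_cast hpos
      positivity
    calc _ ≤ ∑ r₁ ∈ I h₁, ∑ r₂ ∈ I h₂, (K * ((h₂ : ℝ) / h₁) * (h₁ : ℝ) ^ (-(1 - lam)) *
          (g * D) ^ (-lam)) *
          (if |freq θ h₁ r₁ - freq θ h₂ r₂| < 1 then (r₁ : ℝ) ^ (-2 : ℝ) else 0) := by
          refine Finset.sum_le_sum fun r₁ hr₁ => Finset.sum_le_sum fun r₂ hr₂ => ?_
          by_cases hcl : |freq θ h₁ r₁ - freq θ h₂ r₂| < 1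
          · by_cases hnf : freq θ h₁ r₁ ≠ freq θ h₂ r₂
            · rw [if_pos ⟨hnf, hcl⟩, if_pos hcl]
              refine (weight_mul_le_of_close hlam (by linarith) hθ hh₁.1 hh₂.1 (hI _ _ hr₁)
                (hI _ _ hr₂) hcl hnf).trans ?_
              have : |freq θ h₁ r₁ - freq θ h₂ r₂| ^ (-lam) ≤ (g * D) ^ (-lam) := by
                refine Real.rpow_le_rpow_of_nonpos (by positivity) ?_ (by linarith)
                refine le_trans ?_ (hdist r₁ r₂)
                nlinarith [mul_pos hG hD0]
              calc K * ((h₂ : ℝ) / h₁) * (r₁ : ℝ) ^ (-2 : ℝ) * (h₁ : ℝ) ^ (-(1 - lam)) *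
                    |freq θ h₁ r₁ - freq θ h₂ r₂| ^ (-lam)
                  ≤ K * ((h₂ : ℝ) / h₁) * (r₁ : ℝ) ^ (-2 : ℝ) * (h₁ : ℝ) ^ (-(1 - lam)) *
                    (g * D) ^ (-lam) := by gcongr
                _ = _ := by ring
            · rw [if_neg fun h => hnf h.1, if_pos hcl]; positivity
          · rw [if_neg fun h => hcl h.2, if_neg hcl, mul_zero]
      _ = (K * ((h₂ : ℝ) / h₁) * (h₁ : ℝ) ^ (-(1 - lam)) * (g * D) ^ (-lam)) *
          ∑ r₁ ∈ I h₁, ∑ r₂ ∈ I h₂,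
          (if |freq θ h₁ r₁ - freq θ h₂ r₂| < 1 then (r₁ : ℝ) ^ (-2 : ℝ) else 0) := by
          simp only [Finset.mul_sum]
      _ ≤ (K * ((h₂ : ℝ) / h₁) * (h₁ : ℝ) ^ (-(1 - lam)) * (g * D) ^ (-lam)) *
          (C₁ * ((g : ℝ) / h₂ * (h₁ : ℝ) ^ (-1 + e))) := by
          gcongr
      _ = K * C₁ * ((g : ℝ) * (g : ℝ) ^ (-lam)) * (h₁ : ℝ) ^ (-3 + lam + e) * D ^ (-lam) := by
          rw [show (-3 + lam + e) = -(1 - lam) + (-1 + e) - 1 by ring,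
            Real.rpow_sub_one H1.ne', Real.rpow_add H1 (-(1 - lam)) (-1 + e), Real.mul_rpow hG.le hD0.le]
          field_simp
      _ ≤ K * C₁ * ((g : ℝ) * (g : ℝ) ^ (-lam)) * ((g : ℝ) * n / 2) ^ (-3 + lam + e) *
          D ^ (-lam) := by
          gcongr _ * ?_ * _
          exact Real.rpow_le_rpow_of_nonpos g2 g1 (by linarith)
      _ = C₂ * ((g : ℝ) ^ (-2 + e) * (n : ℝ) ^ (-2 + lam + 2 * e) *
            ((n : ℝ) ^ (-1 - e) * D ^ (-lam))) := by
          have s1 : (g : ℝ) ^ (-2 + e) = g * (g : ℝ) ^ (-lam) * (g : ℝ) ^ (-3 + lam + e) := by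
            rw [mul_assoc, ← Real.rpow_add hG, ← Real.rpow_one_add' hG.le (by linarith)]
            congr 1; ring
          have s2 : (n : ℝ) ^ (-3 + lam + e) =
              (n : ℝ) ^ (-2 + lam + 2 * e) * (n : ℝ) ^ (-1 - e) := by
            rw [← Real.rpow_add N0]; congr 1; ring
          rw [div_eq_mul_one_div (_ * _) (2 : ℝ), Real.mul_rpow (by positivity) (by positivity),
            Real.mul_rpow (by positivity) (by positivity), hC₂, s1, s2]
          ring
      _ ≤ _ := by
          gcongr _ * (_ * ?_ * _)
          exact Real.rpow_le_rpow_of_nonpos M0 MN (by linarith)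
  calc _ ≤ ∑ h₁ ∈ Finset.Icc 1 H, ∑ h₂ ∈ Finset.Icc 1 h₁,
        f (h₁.gcd h₂) ((h₁ - h₂) / h₁.gcd h₂) ((h₁ + h₂) / h₁.gcd h₂) :=
        Finset.sum_le_sum fun h₁ hh₁ => Finset.sum_le_sum fun h₂ hh₂ => hpt h₁ hh₁ h₂ hh₂
    _ ≤ _ := sum_gcd_le f hf0 H
    _ ≤ ∑ g ∈ Finset.Icc 1 H, ∑ m ∈ Finset.Icc 1 (2 * H),
          C₂ * C₀ * ((g : ℝ) ^ (-1 + (0 : ℝ)) * (m : ℝ) ^ (-1 + 3 * e)) := by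
        refine Finset.sum_le_sum fun g hg => ?_
        rw [Finset.mem_Icc] at hg
        have hG1 : (1 : ℝ) ≤ g := by exact_mod_cast hg.1
        have hG : (0 : ℝ) < g := by linarith
        have hzero : ∑ n ∈ Finset.Icc 1 (2 * H), f g 0 n = 0 := by
          refine Finset.sum_eq_zero fun n _ => ?_
          simp only [hf, Nat.cast_zero]
          rw [Real.zero_rpow (by linarith)]
          ring
        have hsplit : ∑ m ∈ Finset.range (2 * H + 1), ∑ n ∈ Finset.Icc 1 (2 * H), f g m n =
            ∑ m ∈ Finset.Icc 1 (2 * H), ∑ n ∈ Finset.Icc 1 (2 * H), f g m n := by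
          symm
          refine Finset.sum_subset ?_ ?_
          · intro m hm
            rw [Finset.mem_Icc] at hm
            rw [Finset.mem_range]; omega
          · intro m hm hm'
            rw [Finset.mem_range] at hm
            rw [Finset.mem_Icc] at hm'
            obtain rfl : m = 0 := by omega
            exact hzero
        rw [hsplit]
        refine Finset.sum_le_sum fun m hm => ?_
        rw [Finset.mem_Icc] at hm
        have M0 : (0 : ℝ) < m := by exact_mod_cast hm.1
        have hsum := hC₀ (g * m) (Nat.mul_pos hg.1 hm.1) (Finset.Icc 1 (2 * H))
          (fun n hn => (Finset.mem_Icc.1 hn).1)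
        simp only [hf, ← Finset.mul_sum]
        calc _ ≤ C₂ * ((g : ℝ) ^ (-2 + e) * (m : ℝ) ^ (-2 + lam + 2 * e) *
              (C₀ * ((g * m : ℕ) : ℝ) ^ (1 - lam + e))) := by gcongr
          _ = C₂ * C₀ * (((g : ℝ) ^ (-2 + e) * (g : ℝ) ^ (1 - lam + e)) *
              ((m : ℝ) ^ (-2 + lam + 2 * e) * (m : ℝ) ^ (1 - lam + e))) := by
              push_cast
              rw [Real.mul_rpow hG.le M0.le]; ring
          _ = C₂ * C₀ * ((g : ℝ) ^ (-1 - lam + 2 * e) * (m : ℝ) ^ (-1 + 3 * e)) := by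
              rw [← Real.rpow_add hG, ← Real.rpow_add M0]
              congr 3 <;> ring
          _ ≤ _ := by
              gcongr _ * (?_ * _)
              exact Real.rpow_le_rpow_of_exponent_le hG1 (by linarith)
    _ = C₂ * C₀ * ((∑ g ∈ Finset.Icc 1 H, (g : ℝ) ^ (-1 + (0 : ℝ))) *
          ∑ m ∈ Finset.Icc 1 (2 * H), (m : ℝ) ^ (-1 + 3 * e)) := by
        rw [Finset.sum_mul_sum]; simp only [Finset.mul_sum]
    _ ≤ C₂ * C₀ * (((H : ℝ) ^ (0 + e) * pSeries e) *
          (((2 * H : ℕ) : ℝ) ^ (3 * e + e) * pSeries e)) := by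
        gcongr
        · exact sum_Icc_rpow_le he (by linarith) H
        · exact sum_Icc_rpow_le he (by linarith) (2 * H)
    _ = _ := by
        push_cast
        rw [Real.mul_rpow (by norm_num) (by positivity), zero_add,
          show 3 * e + e = 4 * e by ring, show 5 * e = e + 4 * e by ring,
          Real.rpow_add_of_nonneg (x := (H : ℝ)) (by positivity) (by positivity) (by positivity)]
        ring

lemma sum_sigma_sigma (A : Finset ℕ) (I : ℕ → Finset ℕ) (F : ℕ → ℕ → ℕ → ℕ → ℝ) :
    ∑ p ∈ A.sigma I, ∑ q ∈ A.sigma I, F p.1 q.1 p.2 q.2 =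
      ∑ h₁ ∈ A, ∑ h₂ ∈ A, ∑ r₁ ∈ I h₁, ∑ r₂ ∈ I h₂, F h₁ h₂ r₁ r₂ := by
  simp only [Finset.sum_sigma]
  exact Finset.sum_congr rfl fun h₁ _ => Finset.sum_comm

lemma sum_rpow_mul_rpow_le {θ e : ℝ} (hθ : 0 < θ) (he : 0 < e) (he1 : e ≤ 1 / 2) (H : ℕ)
    (I : ℕ → Finset ℕ) (hI : ∀ h, ∀ r ∈ I h, θ * h < (r : ℝ)) :
    ∑ p ∈ (Finset.Icc 1 H).sigma I,
        (p.1 : ℝ) ^ (-(1 : ℝ) / 2) * (2 * (p.2 : ℝ) - θ * p.1) ^ (-(3 : ℝ) / 2) ≤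
      θ ^ (-(1 / 2) + e) * pSeries e ^ 2 * (H : ℝ) ^ (2 * e) := by
  have hZ := one_le_pSeries he
  rw [Finset.sum_sigma]
  calc _ ≤ ∑ h ∈ Finset.Icc 1 H, ∑ r ∈ I h,
        θ ^ (-(1 / 2) + e) * (h : ℝ) ^ (-1 + e) * (r : ℝ) ^ (-1 - e) := by
        refine Finset.sum_le_sum fun h hh => Finset.sum_le_sum fun r hr => ?_
        have hr := hI h r hr
        have H0 : (0 : ℝ) < h := by exact_mod_cast (Finset.mem_Icc.1 hh).1
        have hth : 0 < θ * h := by positivity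
        have R0 : (0 : ℝ) < r := hth.trans hr
        have a0 := two_mul_sub_pos hθ hr
        have a1 := lt_two_mul_sub hr
        rw [show -(3 : ℝ) / 2 = (-(1 / 2) + e) + (-1 - e) by ring, Real.rpow_add a0]
        calc (h : ℝ) ^ (-(1 : ℝ) / 2) * ((2 * (r : ℝ) - θ * h) ^ (-(1 / 2) + e) *
              (2 * (r : ℝ) - θ * h) ^ (-1 - e))
            ≤ (h : ℝ) ^ (-(1 : ℝ) / 2) * ((θ * h) ^ (-(1 / 2) + e) * (r : ℝ) ^ (-1 - e)) := by
              gcongr _ * (?_ * ?_)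
              · exact Real.rpow_le_rpow_of_nonpos hth (by linarith) (by linarith)
              · exact Real.rpow_le_rpow_of_nonpos R0 a1.le (by linarith)
          _ = _ := by
              rw [Real.mul_rpow hθ.le H0.le, show -1 + e = -(1 : ℝ) / 2 + (-(1 / 2) + e) by ring,
                Real.rpow_add H0 (-(1 : ℝ) / 2)]
              ring
    _ ≤ ∑ h ∈ Finset.Icc 1 H, θ ^ (-(1 / 2) + e) * (h : ℝ) ^ (-1 + e) * pSeries e := by
        refine Finset.sum_le_sum fun h hh => ?_
        rw [← Finset.mul_sum]
        gcongr
        exact sum_le_pSeries he _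
    _ = θ ^ (-(1 / 2) + e) * pSeries e * ∑ h ∈ Finset.Icc 1 H, (h : ℝ) ^ (-1 + e) := by
        rw [Finset.mul_sum]
        exact Finset.sum_congr rfl fun h _ => by ring
    _ ≤ θ ^ (-(1 / 2) + e) * pSeries e * ((H : ℝ) ^ (e + e) * pSeries e) := by
        gcongr
        exact sum_Icc_rpow_le he (by linarith) H
    _ = _ := by rw [two_mul]; ring

lemma exists_sum_weight_far_le {θ e : ℝ} (hθ : 0 < θ) (he : 0 < e) (he1 : e ≤ 1 / 2) :
    ∃ C : ℝ, 0 < C ∧ ∀ (H M : ℕ) (I : ℕ → Finset ℕ), 0 < M →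
      (∀ h, ∀ r ∈ I h, θ * h < (r : ℝ)) →
      (∀ h ∈ Finset.Icc 1 H, ∀ r ∈ I h, freq θ h r < M) →
      ∑ p ∈ (Finset.Icc 1 H).sigma I, ∑ q ∈ (Finset.Icc 1 H).sigma I,
        (if 1 ≤ |freq θ p.1 p.2 - freq θ q.1 q.2| then
          weight θ p.1 p.2 * weight θ q.1 q.2 *
            (1 / |√(freq θ p.1 p.2) - √(freq θ q.1 q.2)|) else 0) ≤
      C * ((H : ℝ) ^ (4 * e) * (M : ℝ) ^ e) := by
  have hZ := one_le_pSeries he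
  obtain ⟨C₀, hC₀0, hC₀⟩ := exists_sum_inv_close_le hθ he he1
  set B := θ ^ (-(1 / 2) + e) * pSeries e ^ 2 with hB
  have hB0 : 0 < B := by positivity
  refine ⟨2 * B ^ 2 + 12 * pSeries e * C₀, by positivity, fun H M I hM hI hfM => ?_⟩
  have hM1 : (1 : ℝ) ≤ (M : ℝ) ^ e := Real.one_le_rpow (by exact_mod_cast hM) he.le
  set S := (Finset.Icc 1 H).sigma I with hS
  have hSm : ∀ p ∈ S, 0 < p.1 ∧ θ * p.1 < (p.2 : ℝ) := by
    intro p hp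
    rw [hS, Finset.mem_sigma] at hp
    exact ⟨(Finset.mem_Icc.1 hp.1).1, hI _ _ hp.2⟩
  set y : (Σ _ : ℕ, ℕ) → ℝ := fun p =>
    (p.1 : ℝ) ^ (-(1 : ℝ) / 2) * (2 * (p.2 : ℝ) - θ * p.1) ^ (-(3 : ℝ) / 2) with hy
  set x : (Σ _ : ℕ, ℕ) → ℝ := fun p => (2 * (p.2 : ℝ) - θ * p.1)⁻¹ with hx
  have hx0 : ∀ p ∈ S, 0 < x p := fun p hp => inv_pos.2 (two_mul_sub_pos hθ (hSm p hp).2)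
  have hy0 : ∀ p ∈ S, 0 ≤ y p := fun p hp => by
    have := two_mul_sub_pos hθ (hSm p hp).2
    simp only [hy]; positivity
  set ν : (Σ _ : ℕ, ℕ) → ℕ := fun p => ⌊freq θ p.1 p.2⌋₊ with hν
  have hν1 : ∀ p ∈ S, ν p < M := fun p hp => by
    have p0 := freq_pos hθ (hSm p hp).1 (hSm p hp).2
    rw [hS, Finset.mem_sigma] at hp
    exact (Nat.floor_lt p0.le).2 (hfM _ hp.1 _ hp.2)
  have hclose : ∑ p ∈ S, ∑ q ∈ S, (if ν p = ν q then x p * x q else 0) ≤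
      C₀ * (H : ℝ) ^ (4 * e) := by
    refine le_trans ?_ (hC₀ H I hI)
    rw [← sum_sigma_sigma (Finset.Icc 1 H) I (fun h₁ h₂ r₁ r₂ =>
      if |freq θ h₁ r₁ - freq θ h₂ r₂| < 1 then
          (2 * (r₁ : ℝ) - θ * h₁)⁻¹ * (2 * (r₂ : ℝ) - θ * h₂)⁻¹ else 0)]
    refine Finset.sum_le_sum fun p hp => Finset.sum_le_sum fun q hq => ?_
    have p0 := freq_pos hθ (hSm p hp).1 (hSm p hp).2
    have q0 := freq_pos hθ (hSm q hq).1 (hSm q hq).2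
    have xx := mul_pos (hx0 p hp) (hx0 q hq)
    by_cases hpq : ν p = ν q
    · rw [if_pos hpq, if_pos]
      have p1 := Nat.floor_le p0.le
      have p2 := Nat.lt_floor_add_one (freq θ p.1 p.2)
      have q1 := Nat.floor_le q0.le
      have q2 := Nat.lt_floor_add_one (freq θ q.1 q.2)
      simp only [hν] at hpq
      rw [hpq] at p1 p2
      rw [abs_lt]
      constructor <;> linarith
    · rw [if_neg hpq]
      split_ifs
      · exact xx.le
      · exact le_rfl
  have hsumy := sum_rpow_mul_rpow_le hθ he he1 H I hI
  calc _ ≤ ∑ p ∈ S, ∑ q ∈ S, (2 * (y p * y q) +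
        6 * (x p * x q / (1 + |(ν p : ℝ) - ν q|))) := by
        refine Finset.sum_le_sum fun p hp => Finset.sum_le_sum fun q hq => ?_
        split_ifs with hfar
        · exact weight_mul_le_of_far hθ (hSm p hp).1 (hSm q hq).1 (hSm p hp).2 (hSm q hq).2 hfar
        · have := mul_nonneg (hy0 p hp) (hy0 q hq)
          have := mul_pos (hx0 p hp) (hx0 q hq)
          positivity
    _ = 2 * (∑ p ∈ S, y p) ^ 2 +
          6 * ∑ p ∈ S, ∑ q ∈ S, x p * x q / (1 + |(ν p : ℝ) - ν q|) := by
        rw [sq, Finset.sum_mul_sum]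
        simp only [Finset.sum_add_distrib, Finset.mul_sum]
    _ ≤ 2 * (B * (H : ℝ) ^ (2 * e)) ^ 2 +
          6 * (2 * ((M : ℝ) ^ e * pSeries e) * (C₀ * (H : ℝ) ^ (4 * e))) := by
        have h1 := (sum_kernel_le he S x ν M hν1).trans
          (mul_le_mul_of_nonneg_left hclose (by positivity))
        have h2 : 0 ≤ ∑ p ∈ S, y p := Finset.sum_nonneg hy0
        gcongr
    _ = 2 * B ^ 2 * (H : ℝ) ^ (4 * e) * 1 +
          12 * pSeries e * C₀ * ((H : ℝ) ^ (4 * e) * (M : ℝ) ^ e) := by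
        rw [mul_pow, ← Real.rpow_natCast ((H : ℝ) ^ (2 * e)), ← Real.rpow_mul (by positivity),
          show 2 * e * (2 : ℕ) = 4 * e by push_cast; ring]
        ring
    _ ≤ 2 * B ^ 2 * (H : ℝ) ^ (4 * e) * (M : ℝ) ^ e +
          12 * pSeries e * C₀ * ((H : ℝ) ^ (4 * e) * (M : ℝ) ^ e) := by gcongr
    _ = _ := by ring

lemma exists_sum_weight_min_le {θ γ lam c e : ℝ} (hθ : 0 < θ) (hγ : 0 < γ) (hc : 0 < c)
    (he : 0 < e) (hlam : 0 < lam) (hlam1 : lam ≤ 1 / 2) (hγlam : γ * lam < 1 - lam + e)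
    (hle : e ≤ lam / 2)
    (hα : ∀ q : ℕ, 0 < q → ∀ z : ℤ, c * (q : ℝ) ^ (-γ) ≤ |θ / 2 * q - z|) :
    ∃ C : ℝ, 0 < C ∧ ∀ (H M : ℕ) (I : ℕ → Finset ℕ), 0 < M →
      (∀ h, ∀ r ∈ I h, θ * h < (r : ℝ)) →
      (∀ h ∈ Finset.Icc 1 H, ∀ r ∈ I h, freq θ h r < M) → ∀ K : ℝ, 1 ≤ K →
      ∑ p ∈ (Finset.Icc 1 H).sigma I, ∑ q ∈ (Finset.Icc 1 H).sigma I,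
        (if freq θ p.1 p.2 ≠ freq θ q.1 q.2 then
          weight θ p.1 p.2 * weight θ q.1 q.2 *
            min K (1 / |√(freq θ p.1 p.2) - √(freq θ q.1 q.2)|) else 0) ≤
      C * (K ^ (1 - lam) * (H : ℝ) ^ (5 * e) * (M : ℝ) ^ e) := by
  obtain ⟨C₁, hC₁0, hC₁⟩ := exists_sum_weight_close_le hθ hγ hc he hlam hlam1 hγlam hle hα
  obtain ⟨C₂, hC₂0, hC₂⟩ := exists_sum_weight_far_le hθ he (by linarith)
  refine ⟨C₁ + C₂, by positivity, fun H M I hM hI hfM K hK => ?_⟩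
  have hM1 : (1 : ℝ) ≤ (M : ℝ) ^ e := Real.one_le_rpow (by exact_mod_cast hM) he.le
  have hK1 : (1 : ℝ) ≤ K ^ (1 - lam) := Real.one_le_rpow hK (by linarith)
  have hK0 : 0 < K := by linarith
  have h1 := hC₁ H I hI
  rw [← sum_sigma_sigma (Finset.Icc 1 H) I (fun h₁ h₂ r₁ r₂ =>
    if freq θ h₁ r₁ ≠ freq θ h₂ r₂ ∧ |freq θ h₁ r₁ - freq θ h₂ r₂| < 1 then
          weight θ h₁ r₁ * weight θ h₂ r₂ *
            (1 / |√(freq θ h₁ r₁) - √(freq θ h₂ r₂)|) ^ lam else 0)] at h1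
  have h2 := hC₂ H M I hM hI hfM
  have hH : (H : ℝ) ^ (4 * e) ≤ (H : ℝ) ^ (5 * e) := by
    rcases Nat.eq_zero_or_pos H with rfl | hH
    · rw [Nat.cast_zero, Real.zero_rpow (by positivity), Real.zero_rpow (by positivity)]
    · exact Real.rpow_le_rpow_of_exponent_le (by exact_mod_cast hH) (by linarith)
  set S := (Finset.Icc 1 H).sigma I with hS
  have hSm : ∀ p ∈ S, 0 < p.1 ∧ θ * p.1 < (p.2 : ℝ) := by
    intro p hp
    rw [hS, Finset.mem_sigma] at hp
    exact ⟨(Finset.mem_Icc.1 hp.1).1, hI _ _ hp.2⟩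
  calc _ ≤ ∑ p ∈ S, ∑ q ∈ S, (K ^ (1 - lam) *
        (if freq θ p.1 p.2 ≠ freq θ q.1 q.2 ∧ |freq θ p.1 p.2 - freq θ q.1 q.2| < 1 then
          weight θ p.1 p.2 * weight θ q.1 q.2 *
            (1 / |√(freq θ p.1 p.2) - √(freq θ q.1 q.2)|) ^ lam else 0) +
        (if 1 ≤ |freq θ p.1 p.2 - freq θ q.1 q.2| then
          weight θ p.1 p.2 * weight θ q.1 q.2 *
            (1 / |√(freq θ p.1 p.2) - √(freq θ q.1 q.2)|) else 0)) := by
        refine Finset.sum_le_sum fun p hp => Finset.sum_le_sum fun q hq => ?_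
        have p0 := weight_pos hθ (hSm p hp).1 (hSm p hp).2
        have q0 := weight_pos hθ (hSm q hq).1 (hSm q hq).2
        set z := 1 / |√(freq θ p.1 p.2) - √(freq θ q.1 q.2)| with hz
        have hz0 : 0 ≤ z := by positivity
        by_cases hne : freq θ p.1 p.2 ≠ freq θ q.1 q.2
        · rw [if_pos hne]
          rcases lt_or_ge |freq θ p.1 p.2 - freq θ q.1 q.2| 1 with hcl | hfar
          · rw [if_pos ⟨hne, hcl⟩, if_neg (not_le.2 hcl), add_zero]
            have hmin : min K z ≤ K ^ (1 - lam) * z ^ lam := by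
              have hm0 : 0 ≤ min K z := le_min hK0.le hz0
              calc min K z = min K z ^ (1 - lam) * min K z ^ lam := by
                    rw [← Real.rpow_add_of_nonneg hm0 (by linarith) hlam.le, sub_add_cancel,
                      Real.rpow_one]
                _ ≤ _ := by
                    gcongr
                    · linarith
                    · exact min_le_left _ _
                    · exact min_le_right _ _
            calc _ ≤ weight θ p.1 p.2 * weight θ q.1 q.2 * (K ^ (1 - lam) * z ^ lam) := by gcongr
              _ = _ := by ring
          · rw [if_neg fun h => absurd h.2 (not_lt.2 hfar), if_pos hfar, mul_zero, zero_add]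
            gcongr
            exact min_le_right _ _
        · rw [if_neg hne, if_neg fun h => hne h.1, mul_zero, zero_add]
          split_ifs <;> positivity
    _ = K ^ (1 - lam) * ∑ p ∈ S, ∑ q ∈ S,
        (if freq θ p.1 p.2 ≠ freq θ q.1 q.2 ∧ |freq θ p.1 p.2 - freq θ q.1 q.2| < 1 then
          weight θ p.1 p.2 * weight θ q.1 q.2 *
            (1 / |√(freq θ p.1 p.2) - √(freq θ q.1 q.2)|) ^ lam else 0) +
        ∑ p ∈ S, ∑ q ∈ S, (if 1 ≤ |freq θ p.1 p.2 - freq θ q.1 q.2| then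
          weight θ p.1 p.2 * weight θ q.1 q.2 *
            (1 / |√(freq θ p.1 p.2) - √(freq θ q.1 q.2)|) else 0) := by
        simp only [Finset.sum_add_distrib, Finset.mul_sum]
    _ ≤ K ^ (1 - lam) * (C₁ * (H : ℝ) ^ (5 * e)) * 1 +
          1 * (C₂ * ((H : ℝ) ^ (4 * e) * (M : ℝ) ^ e)) := by
        rw [mul_one, one_mul]
        gcongr
    _ ≤ K ^ (1 - lam) * (C₁ * (H : ℝ) ^ (5 * e)) * (M : ℝ) ^ e +
          K ^ (1 - lam) * (C₂ * ((H : ℝ) ^ (5 * e) * (M : ℝ) ^ e)) := by gcongr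
    _ = _ := by ring

lemma abs_uCoef_le (l : ℕ) {θ : ℝ} {h r : ℕ} (hθ : 0 < θ) (hr : θ * h < r) :
    |uCoef l θ h r| ≤ weight θ h r := by
  have h0 : 0 ≤ θ * h := by positivity
  have a0 := two_mul_sub_pos hθ hr
  have q0 : 0 ≤ θ * h / (2 * (r : ℝ) - θ * h) := by positivity
  have q1 : θ * h / (2 * (r : ℝ) - θ * h) ≤ 1 := by rw [div_le_one a0]; linarith
  have hw : 0 ≤ weight θ h r := by unfold weight; positivity
  have hu : uCoef l θ h r = (-1 : ℝ) ^ (l * h) *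
      (weight θ h r * (1 - θ * h / (2 * (r : ℝ) - θ * h)) ^ (l - 1)) := by
    unfold uCoef weight; ring
  rw [hu, abs_mul, abs_pow, abs_neg, abs_one, one_pow, one_mul, abs_mul, abs_of_nonneg hw, abs_pow]
  refine mul_le_of_le_one_right hw (pow_le_one₀ (abs_nonneg _) ?_)
  rw [abs_le]
  constructor <;> linarith

lemma two_pow_Jdef_le {T : ℝ} (hT : 3 ≤ T) : (2 : ℝ) ^ (2 * Jdef T + 1) ≤ 2 * T := by
  have hT0 : 0 < T := by linarith
  have hlog : 1 ≤ Real.log T := by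
    rw [Real.le_log_iff_exp_le hT0]
    linarith [Real.exp_one_lt_d9]
  have hll : 0 ≤ Real.log (Real.log T) := Real.log_nonneg hlog
  have hll' : Real.log (Real.log T) ≤ Real.log T := (Real.log_le_sub_one_of_pos (by linarith)).trans
    (by linarith)
  have h2 : 0 < Real.log 2 := Real.log_pos one_lt_two
  have hJ : (Jdef T : ℝ) ≤ (Real.log T - Real.log (Real.log T)) / (2 * Real.log 2) :=
    Nat.floor_le (div_nonneg (by linarith) (by positivity))
  rw [le_div_iff₀ (by positivity)] at hJ
  rw [pow_succ, mul_comm]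
  gcongr
  rw [← Real.log_le_log_iff (by positivity) hT0, Real.log_pow]
  push_cast
  linarith

lemma freq_lt_of_le {θ T : ℝ} (hθ : 0 < θ) (hT : 3 ≤ T) {h r : ℕ} (hh : h ≤ ⌊(T ^ 2 : ℝ)⌋₊)
    (hr : r ≤ ⌊θ * h * (2 ^ (2 * Jdef T + 1) + 1 / 2)⌋₊) :
    freq θ h r < (⌊6 * θ * T ^ 5⌋₊ + 1 : ℕ) := by
  have hT0 : 0 < T := by linarith
  have hH : (h : ℝ) ≤ T ^ 2 := (Nat.le_floor_iff (by positivity)).1 hh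
  have hR : (r : ℝ) ≤ θ * h * (2 ^ (2 * Jdef T + 1) + 1 / 2) :=
    (Nat.le_floor_iff (by positivity)).1 hr
  have hJ := two_pow_Jdef_le hT
  push_cast
  refine lt_of_le_of_lt ?_ (Nat.lt_floor_add_one _)
  have hh0 : (0 : ℝ) ≤ θ * h := by positivity
  calc freq θ h r ≤ h * (2 * r) := by unfold freq; gcongr; linarith
    _ ≤ h * (2 * (θ * h * (2 ^ (2 * Jdef T + 1) + 1 / 2))) := by gcongr
    _ ≤ T ^ 2 * (2 * (θ * T ^ 2 * (2 * T + T))) := by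
        gcongr
        linarith
    _ = _ := by ring

lemma abs_integral_cos_min_le {b T s t : ℝ} (hb : 1 / 2 ≤ b) (hT : 0 < T) (hne : s ≠ t) :
    |∫ x in T..(2 * T), x ^ b * Real.cos (2 * Real.pi * √x * (s - t))| ≤
      (2 ^ b + (2 ^ (b + 1 / 2) + 1 + (b + 1 / 2) * 2 ^ (b - 1 / 2))) *
        (T ^ (b + 1 / 2) * min (T ^ (1 / 2 : ℝ)) (1 / |s - t|)) := by
  have hst : 0 < |s - t| := abs_pos.2 (sub_ne_zero.2 hne)
  have h1 := abs_integral_rpow_mul_le (b := b) (by linarith) hT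
    (fun x => Real.cos (2 * Real.pi * √x * (s - t))) (fun x => Real.abs_cos_le_one _)
  have h2 := abs_integral_cos_sqrt_le (κ := 2 * Real.pi * (s - t)) hb hT
    (mul_ne_zero (by positivity) (sub_ne_zero.2 hne))
  simp only [show ∀ x : ℝ, 2 * Real.pi * (s - t) * √x = 2 * Real.pi * √x * (s - t) from
    fun x => by ring] at h2
  set D := (2 : ℝ) ^ (b + 1 / 2) + 1 + (b + 1 / 2) * 2 ^ (b - 1 / 2) with hD
  have hD0 : 0 ≤ D := by
    have : 0 ≤ b + 1 / 2 := by linarith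
    positivity
  have hb2 : (0 : ℝ) ≤ 2 ^ b := by positivity
  rcases min_cases (T ^ (1 / 2 : ℝ)) (1 / |s - t|) with ⟨h, _⟩ | ⟨h, _⟩ <;> rw [h]
  · refine h1.trans ?_
    rw [← Real.rpow_add hT, show b + 1 / 2 + 1 / 2 = b + 1 by ring]
    gcongr
    linarith
  · refine h2.trans ?_
    rw [abs_mul, abs_of_pos (by positivity : 0 < 2 * Real.pi)]
    calc 2 / (2 * Real.pi * |s - t|) * (D * T ^ (b + 1 / 2))
        ≤ 1 / |s - t| * (D * T ^ (b + 1 / 2)) := by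
          gcongr ?_ * _
          rw [div_le_div_iff₀ (by positivity) hst]
          nlinarith [Real.pi_gt_three]
      _ = D * (T ^ (b + 1 / 2) * (1 / |s - t|)) := by ring
      _ ≤ _ := by
          gcongr
          linarith

lemma abs_integral_sum_le {ι : Type*} {b T A : ℝ} (hb : 1 / 2 ≤ b) (hT : 0 < T) (hA : 0 ≤ A)
    (S : Finset ι) (s u w : ι → ℝ) (hu : ∀ p ∈ S, |u p| ≤ w p) :
    |∫ x in T..(2 * T), A * x ^ b * ∑ p ∈ S, ∑ q ∈ S,
        if s p ≠ s q then u p * u q * Real.cos (2 * Real.pi * √x * (s p - s q)) else 0| ≤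
      A * ((2 ^ b + (2 ^ (b + 1 / 2) + 1 + (b + 1 / 2) * 2 ^ (b - 1 / 2))) * T ^ (b + 1 / 2)) *
        ∑ p ∈ S, ∑ q ∈ S,
          if s p ≠ s q then w p * w q * min (T ^ (1 / 2 : ℝ)) (1 / |s p - s q|) else 0 := by
  set D := (2 : ℝ) ^ b + (2 ^ (b + 1 / 2) + 1 + (b + 1 / 2) * 2 ^ (b - 1 / 2)) with hD
  have hw : ∀ p ∈ S, 0 ≤ w p := fun p hp => (abs_nonneg _).trans (hu p hp)
  have hcont : ∀ y : ℝ, Continuous fun x : ℝ => x ^ b * Real.cos (2 * Real.pi * √x * y) :=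
    fun y => (Real.continuous_rpow_const (by linarith)).mul (by fun_prop)
  have hrw : ∀ x : ℝ, (A * x ^ b * ∑ p ∈ S, ∑ q ∈ S,
        if s p ≠ s q then u p * u q * Real.cos (2 * Real.pi * √x * (s p - s q)) else 0) =
      ∑ p ∈ S, ∑ q ∈ S, (if s p ≠ s q then A * (u p * u q) else 0) *
        (x ^ b * Real.cos (2 * Real.pi * √x * (s p - s q))) := by
    intro x
    simp only [Finset.mul_sum]
    refine Finset.sum_congr rfl fun p _ => Finset.sum_congr rfl fun q _ => ?_
    split_ifs <;> ring
  simp only [hrw]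
  rw [intervalIntegral.integral_finsetSum fun p _ => (Continuous.intervalIntegrable
    (continuous_finsetSum _ fun q _ => (hcont _).const_mul _) _ _)]
  rw [Finset.mul_sum]
  refine (Finset.abs_sum_le_sum_abs _ _).trans (Finset.sum_le_sum fun p hp => ?_)
  rw [intervalIntegral.integral_finsetSum fun q _ =>
    ((hcont _).const_mul _).intervalIntegrable _ _]
  rw [Finset.mul_sum]
  refine (Finset.abs_sum_le_sum_abs _ _).trans (Finset.sum_le_sum fun q hq => ?_)
  rw [intervalIntegral.integral_const_mul, abs_mul]
  by_cases hne : s p ≠ s q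
  · rw [if_pos hne, if_pos hne, abs_mul, abs_mul, abs_of_nonneg hA]
    calc A * (|u p| * |u q|) * _ ≤ A * (w p * w q) *
          (D * (T ^ (b + 1 / 2) * min (T ^ (1 / 2 : ℝ)) (1 / |s p - s q|))) := by
          have hp0 := hw p hp
          have hq0 := hw q hq
          gcongr A * (?_ * ?_) * ?_
          · exact hu p hp
          · exact hu q hq
          · exact abs_integral_cos_min_le hb hT hne
      _ = _ := by ring
  · rw [if_neg hne, if_neg hne, abs_zero, zero_mul, mul_zero]

open Classical in
/-- Estimate (5.22), the `S₂` integral: for `l ≥ 1` and irrational `θ > 0` of finite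
approximation type `γ ≥ 1`, for every `ε > 0` there are `C > 0` and `T₀ ≥ 3` such that for
all `T ≥ T₀`, with `H = T²`, `J = ⌊(log T − log log T)/(2 log 2)⌋` and
`S₂(x) = (2^{3−2l}·x^{2l−1/2}/(π²·((l−1)!)²)) · Σ u(h₁,r₁)·u(h₂,r₂)·
cos(2π√x·(√(h₁(2r₁ − θh₁)) − √(h₂(2r₂ − θh₂))))` (sum over `1 ≤ hⱼ ≤ H`,
`θhⱼ < rⱼ ≤ θhⱼ(2^{2J+1} + 1/2)` and `√(h₁(2r₁ − θh₁)) ≠ √(h₂(2r₂ − θh₂))`), one has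
`|∫_T^{2T} S₂(x) dx| ≤ C·T^{2l + 1/2 − 1/(2(1+γ)) + ε}`. -/
theorem S2_integral (l : ℕ) (hl : 1 ≤ l) (θ γ : ℝ) (hθ : 0 < θ) (hirr : Irrational θ)
    (htype : IsApproxType θ γ) (ε : ℝ) (hε : 0 < ε) :
    ∃ C : ℝ, 0 < C ∧ ∃ T₀ : ℝ, 3 ≤ T₀ ∧ ∀ T : ℝ, T₀ ≤ T →
      |∫ x in T..(2 * T),
          ((2 : ℝ) ^ ((3 : ℤ) - 2 * l) * x ^ (2 * (l : ℝ) - 1 / 2) /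
              (Real.pi ^ 2 * ((l - 1).factorial : ℝ) ^ 2)) *
            ∑ h₁ ∈ Finset.Icc 1 ⌊(T ^ 2 : ℝ)⌋₊,
              ∑ r₁ ∈ Finset.Ioc ⌊θ * h₁⌋₊ ⌊θ * h₁ * (2 ^ (2 * Jdef T + 1) + 1 / 2)⌋₊,
                ∑ h₂ ∈ Finset.Icc 1 ⌊(T ^ 2 : ℝ)⌋₊,
                  ∑ r₂ ∈ Finset.Ioc ⌊θ * h₂⌋₊ ⌊θ * h₂ * (2 ^ (2 * Jdef T + 1) + 1 / 2)⌋₊,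
                    if Real.sqrt ((h₁ : ℝ) * (2 * r₁ - θ * h₁)) ≠
                        Real.sqrt ((h₂ : ℝ) * (2 * r₂ - θ * h₂)) then
                      uCoef l θ h₁ r₁ * uCoef l θ h₂ r₂ *
                        Real.cos (2 * Real.pi * Real.sqrt x *
                          (Real.sqrt ((h₁ : ℝ) * (2 * r₁ - θ * h₁)) -
                            Real.sqrt ((h₂ : ℝ) * (2 * r₂ - θ * h₂))))
                    else 0| ≤
        C * T ^ (2 * (l : ℝ) + 1 / 2 - 1 / (2 * (1 + γ)) + ε) := by
  obtain ⟨hγ1, htype⟩ := htype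
  have hγ0 : 0 < 1 + γ := by linarith
  set lam := 1 / (1 + γ) with hlam
  have hlam0 : 0 < lam := by positivity
  have hlam1 : lam ≤ 1 / 2 := one_div_le_one_div_of_le two_pos (by linarith)
  have hγlam : γ * lam = 1 - lam := by rw [hlam]; field_simp; ring
  set e := min (ε / 15) (lam / 2) with he_def
  have he : 0 < e := lt_min (by positivity) (by positivity)
  have he1 : e ≤ ε / 15 := min_le_left _ _
  have he2 : e ≤ lam / 2 := min_le_right _ _
  obtain ⟨c, hc, hα⟩ := htype e he
  obtain ⟨C, hC0, hC⟩ := exists_sum_weight_min_le (γ := γ + e) (c := c / 2) hθ (by linarith)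
    (half_pos hc) he hlam0 hlam1 (by nlinarith) he2 (by
      intro q hq z
      have q0 : (0 : ℝ) < q := by exact_mod_cast hq
      have h := hα (2 * z) q hq
      calc c / 2 * (q : ℝ) ^ (-(γ + e)) = (q : ℝ) / 2 * (c * (q : ℝ) ^ (-γ - 1 - e)) := by
            rw [show -γ - 1 - e = -(γ + e) - 1 by ring, Real.rpow_sub_one q0.ne']
            field_simp
        _ ≤ (q : ℝ) / 2 * |θ - ((2 * z : ℤ) : ℝ) / q| := by gcongr
        _ = |θ / 2 * q - z| := by
            rw [← abs_of_pos (half_pos q0), ← abs_mul]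
            congr 1
            push_cast
            field_simp)
  set A := (2 : ℝ) ^ ((3 : ℤ) - 2 * l) / (Real.pi ^ 2 * ((l - 1).factorial : ℝ) ^ 2) with hA
  have hA0 : 0 < A := by positivity
  have hl1 : (1 : ℝ) ≤ l := by exact_mod_cast hl
  set b := 2 * (l : ℝ) - 1 / 2 with hb
  have hb1 : 1 / 2 ≤ b := by linarith
  set D := (2 : ℝ) ^ b + (2 ^ (b + 1 / 2) + 1 + (b + 1 / 2) * 2 ^ (b - 1 / 2)) with hD
  have hD0 : 0 < D := by
    have : 0 ≤ b + 1 / 2 := by linarith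
    positivity
  refine ⟨A * D * (C * (6 * θ + 1) ^ e), by positivity, 3, le_rfl, fun T hT => ?_⟩
  have hT0 : 0 < T := by linarith
  have hT1 : 1 ≤ T := by linarith
  set H := ⌊(T ^ 2 : ℝ)⌋₊ with hH
  set I : ℕ → Finset ℕ := fun h =>
    Finset.Ioc ⌊θ * h⌋₊ ⌊θ * h * (2 ^ (2 * Jdef T + 1) + 1 / 2)⌋₊ with hI
  have hI1 : ∀ h, ∀ r ∈ I h, θ * h < (r : ℝ) := fun h r hr =>
    Nat.lt_of_floor_lt (Finset.mem_Ioc.1 hr).1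
  set M := ⌊6 * θ * T ^ 5⌋₊ + 1 with hM
  have hIM : ∀ h ∈ Finset.Icc 1 H, ∀ r ∈ I h, freq θ h r < M := fun h hh r hr =>
    freq_lt_of_le hθ hT (Finset.mem_Icc.1 hh).2 (Finset.mem_Ioc.1 hr).2
  have hsum := hC H M I (Nat.succ_pos _) hI1 hIM (T ^ (1 / 2 : ℝ))
    (Real.one_le_rpow hT1 (by norm_num))
  set S := (Finset.Icc 1 H).sigma I with hS
  have hSm : ∀ p ∈ S, 0 < p.1 ∧ θ * p.1 < (p.2 : ℝ) := fun p hp => by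
    rw [hS, Finset.mem_sigma] at hp
    exact ⟨(Finset.mem_Icc.1 hp.1).1, hI1 _ _ hp.2⟩
  have hbound := abs_integral_sum_le (A := A) hb1 hT0 hA0.le S (fun p => √(freq θ p.1 p.2))
    (fun p => uCoef l θ p.1 p.2) (fun p => weight θ p.1 p.2)
    (fun p hp => abs_uCoef_le l hθ (hSm p hp).2)
  have hHe : (H : ℝ) ^ (5 * e) ≤ T ^ (10 * e) := by
    have h1 : (H : ℝ) ≤ T ^ (2 : ℝ) := by
      rw [Real.rpow_two]; exact Nat.floor_le (by positivity)
    calc (H : ℝ) ^ (5 * e) ≤ (T ^ (2 : ℝ)) ^ (5 * e) := by gcongr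
      _ = _ := by rw [← Real.rpow_mul hT0.le]; congr 1; ring
  have hMe : (M : ℝ) ^ e ≤ (6 * θ + 1) ^ e * T ^ (5 * e) := by
    have h1 : (M : ℝ) ≤ (6 * θ + 1) * T ^ (5 : ℝ) := by
      have h2 : ((⌊6 * θ * T ^ 5⌋₊ : ℕ) : ℝ) ≤ 6 * θ * T ^ 5 := Nat.floor_le (by positivity)
      have h3 : 1 ≤ T ^ 5 := one_le_pow₀ hT1
      rw [show T ^ (5 : ℝ) = T ^ 5 by exact_mod_cast Real.rpow_natCast T 5, hM]
      push_cast
      linarith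
    calc (M : ℝ) ^ e ≤ ((6 * θ + 1) * T ^ (5 : ℝ)) ^ e := by gcongr
      _ = _ := by rw [Real.mul_rpow (by positivity) (by positivity), ← Real.rpow_mul hT0.le]
  calc _ = |∫ x in T..(2 * T), A * x ^ b * ∑ p ∈ S, ∑ q ∈ S,
        if √(freq θ p.1 p.2) ≠ √(freq θ q.1 q.2) then
          uCoef l θ p.1 p.2 * uCoef l θ q.1 q.2 *
            Real.cos (2 * Real.pi * √x * (√(freq θ p.1 p.2) - √(freq θ q.1 q.2))) else 0| := by
        congr 1
        refine intervalIntegral.integral_congr fun x _ => ?_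
        simp only [hS, Finset.sum_sigma]
        rw [mul_div_right_comm]
        rfl
    _ ≤ A * (D * T ^ (b + 1 / 2)) * ∑ p ∈ S, ∑ q ∈ S,
          if √(freq θ p.1 p.2) ≠ √(freq θ q.1 q.2) then
            weight θ p.1 p.2 * weight θ q.1 q.2 *
              min (T ^ (1 / 2 : ℝ)) (1 / |√(freq θ p.1 p.2) - √(freq θ q.1 q.2)|) else 0 := hbound
    _ = A * (D * T ^ (b + 1 / 2)) * ∑ p ∈ S, ∑ q ∈ S,
          if freq θ p.1 p.2 ≠ freq θ q.1 q.2 then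
            weight θ p.1 p.2 * weight θ q.1 q.2 *
              min (T ^ (1 / 2 : ℝ)) (1 / |√(freq θ p.1 p.2) - √(freq θ q.1 q.2)|) else 0 := by
        congr 1
        refine Finset.sum_congr rfl fun p hp => Finset.sum_congr rfl fun q hq => ?_
        have p0 := freq_pos hθ (hSm p hp).1 (hSm p hp).2
        have q0 := freq_pos hθ (hSm q hq).1 (hSm q hq).2
        exact if_congr (not_congr (Real.sqrt_inj p0.le q0.le)) rfl rfl
    _ ≤ A * (D * T ^ (b + 1 / 2)) * (C * ((T ^ (1 / 2 : ℝ)) ^ (1 - lam) * T ^ (10 * e) *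
          ((6 * θ + 1) ^ e * T ^ (5 * e)))) := by
        gcongr
        refine hsum.trans ?_
        gcongr
    _ = A * D * (C * (6 * θ + 1) ^ e) *
          T ^ (b + 1 / 2 + 1 / 2 * (1 - lam) + 10 * e + 5 * e) := by
        rw [Real.rpow_add hT0 _ (5 * e), Real.rpow_add hT0 _ (10 * e),
          Real.rpow_add hT0 _ (1 / 2 * (1 - lam)), Real.rpow_mul hT0.le (1 / 2) (1 - lam)]
        ring
    _ ≤ _ := by
        gcongr _ * ?_
        refine Real.rpow_le_rpow_of_exponent_le hT1 ?_
        have h1 : 1 / (2 * (1 + γ)) = lam / 2 := by rw [hlam]; field_simp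
        rw [h1]
        linarith
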